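/- arXiv:1605.07283 — 3 statements merged into one kernel-verified Lean document; each statement's English description precedes it below -/
import Mathlib

section
/- Let X be a subshift over a finite alphabet with language L, and suppose there exists G ⊆ L which has (W)-specification (for some gap length τ) and such that L is edit approachable by G. If ψ : ℕ → (0,∞) satisfies liminf_{n→∞} ψ(n) > 0, then the Hausdorff dimension of R(ψ) equals h, where h = h_top(X) is the topological entropy of X. -/
open Filter MeasureTheory Set
open scoped ENNReal NNReal

noncomputable section

def SeqSpace (A : Type*) : Type _ := ℕ → A

namespace SeqSpace

variable {A : Type*}

/-- `|u ∧ v|`: the length of the longest common prefix of `u` and `v`. -/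
def lcp (u v : SeqSpace A) : ℕ := sInf {n | u n ≠ v n}

theorem lcp_mem {u v : SeqSpace A} (h : u ≠ v) : u (lcp u v) ≠ v (lcp u v) := by
  have hne : {n | u n ≠ v n}.Nonempty := by
    rcases Function.ne_iff.mp h with ⟨n, hn⟩
    exact ⟨n, hn⟩
  exact Nat.sInf_mem hne

theorem min_lcp_le (u v w : SeqSpace A) (huw : u ≠ w) :
    min (lcp u v) (lcp v w) ≤ lcp u w := by
  by_cases h : u (lcp u w) = v (lcp u w)
  · have hvw : v (lcp u w) ≠ w (lcp u w) := h ▸ lcp_mem huw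
    exact le_trans (min_le_right _ _) (Nat.sInf_le hvw)
  · exact le_trans (min_le_left _ _) (Nat.sInf_le h)

open scoped Classical in
/-- The metric `d(u,v) = e^{-|u ∧ v|}`. -/
def sdist (u v : SeqSpace A) : ℝ :=
  if u = v then 0 else Real.exp (-(lcp u v : ℝ))

theorem sdist_nonneg' (u v : SeqSpace A) : 0 ≤ sdist u v := by
  unfold sdist
  split
  · exact le_refl 0
  · exact (Real.exp_pos _).le

theorem lcp_comm (u v : SeqSpace A) : lcp u v = lcp v u := by
  unfold lcp
  congr 1
  ext n
  exact ne_comm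

theorem sdist_self' (u : SeqSpace A) : sdist u u = 0 := by simp [sdist]

theorem sdist_comm' (u v : SeqSpace A) : sdist u v = sdist v u := by
  unfold sdist
  by_cases h : u = v
  · simp [h]
  · rw [if_neg h, if_neg (Ne.symm h), lcp_comm]

theorem sdist_triangle' (u v w : SeqSpace A) : sdist u w ≤ sdist u v + sdist v w := by
  by_cases huw : u = w
  · rw [show sdist u w = 0 by rw [huw]; exact sdist_self' w]
    exact add_nonneg (sdist_nonneg' _ _) (sdist_nonneg' _ _)
  by_cases huv : u = v
  · subst huv
    rw [sdist_self', zero_add]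
  by_cases hvw : v = w
  · subst hvw
    rw [sdist_self', add_zero]
  simp only [sdist, if_neg huw, if_neg huv, if_neg hvw]
  have h1 : min (lcp u v) (lcp v w) ≤ lcp u w := min_lcp_le u v w huw
  rcases le_total (lcp u v) (lcp v w) with hle | hle
  · have h2 : lcp u v ≤ lcp u w := by rw [min_eq_left hle] at h1; exact h1
    have h3 : Real.exp (-(lcp u w : ℝ)) ≤ Real.exp (-(lcp u v : ℝ)) :=
      Real.exp_le_exp.mpr (by exact_mod_cast neg_le_neg (Nat.cast_le.mpr h2))
    linarith [Real.exp_pos (-(lcp v w : ℝ))]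
  · have h2 : lcp v w ≤ lcp u w := by rw [min_eq_right hle] at h1; exact h1
    have h3 : Real.exp (-(lcp u w : ℝ)) ≤ Real.exp (-(lcp v w : ℝ)) :=
      Real.exp_le_exp.mpr (by exact_mod_cast neg_le_neg (Nat.cast_le.mpr h2))
    linarith [Real.exp_pos (-(lcp u v : ℝ))]

theorem sdist_eq_zero' {u v : SeqSpace A} (h : sdist u v = 0) : u = v := by
  by_contra hne
  rw [sdist, if_neg hne] at h
  exact (Real.exp_pos _).ne' h

instance : MetricSpace (SeqSpace A) where
  dist := sdist
  dist_self := sdist_self'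
  dist_comm := sdist_comm'
  dist_triangle := sdist_triangle'
  eq_of_dist_eq_zero := sdist_eq_zero'

end SeqSpace

namespace SeqSpace

variable {A : Type*}

/-- The left shift map `σ`. -/
def shift (x : SeqSpace A) : SeqSpace A := fun n => x (n + 1)

/-- The word `w` occurs in `x` starting at position `k`. -/
def OccursAt (w : List A) (x : SeqSpace A) (k : ℕ) : Prop :=
  ∀ i, (h : i < w.length) → x (k + i) = w[i]'h

/-- The language of `X`: all finite words appearing in some point of `X`. -/
def language (X : Set (SeqSpace A)) : Set (List A) :=
  {w | ∃ x ∈ X, ∃ k, OccursAt w x k}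

/-- The cylinder `[w]` of a finite word `w`. -/
def cyl (w : List A) : Set (SeqSpace A) := {x | OccursAt w x 0}

/-- Birkhoff sum `S_n φ = ∑_{k=0}^{n-1} φ ∘ σ^k`. -/
def birkhoff (φ : SeqSpace A → ℝ) (n : ℕ) (x : SeqSpace A) : ℝ :=
  ∑ k ∈ Finset.range n, φ (shift^[k] x)

/-- The words of length `n` in a collection `D` of words. -/
def wordsOfLen (D : Set (List A)) (n : ℕ) : Set (List A) := {w ∈ D | w.length = n}

/-- Topological pressure `P(D,φ)` of a potential `φ` computed over the words of `D`
(the points of the subshift `X` are used to evaluate the Birkhoff sups over cylinders). -/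
def pressure (X : Set (SeqSpace A)) (D : Set (List A)) (φ : SeqSpace A → ℝ) : ℝ :=
  atTop.limsup fun n =>
    Real.log (∑ᶠ w ∈ wordsOfLen D n, Real.exp (sSup (birkhoff φ n '' (X ∩ cyl w)))) / n

/-- The recurrence set `R(ψ)` of points of `X` with `d(σ^n x, x) < ψ(n)` infinitely often. -/
def recSet (X : Set (SeqSpace A)) (ψ : ℕ → ℝ) : Set (SeqSpace A) :=
  {x ∈ X | ∃ᶠ n in atTop, dist (shift^[n] x) x < ψ n}

/-- The recurrence set `R(f)` of points of `X` with `d(σ^n x, x) ≤ e^{-S_n f(x)}`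
infinitely often. -/
def recSetF (X : Set (SeqSpace A)) (f : SeqSpace A → ℝ) : Set (SeqSpace A) :=
  {x ∈ X | ∃ᶠ n in atTop, dist (shift^[n] x) x ≤ Real.exp (-(birkhoff f n x))}

/-- A single edit of a word: substitution, insertion or deletion of one symbol. -/
def EditStep (w w' : List A) : Prop :=
  (∃ (u₁ u₂ : List A) (a a' : A), w = u₁ ++ a :: u₂ ∧ w' = u₁ ++ a' :: u₂) ∨
  (∃ (u₁ u₂ : List A) (a' : A), w = u₁ ++ u₂ ∧ w' = u₁ ++ a' :: u₂) ∨
  (∃ (u₁ u₂ : List A) (a : A), w = u₁ ++ a :: u₂ ∧ w' = u₁ ++ u₂)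

/-- `EditChain n v w` : `v` can be transformed into `w` by `n` edits. -/
def EditChain : ℕ → List A → List A → Prop
  | 0, v, w => v = w
  | n + 1, v, w => ∃ u, EditStep v u ∧ EditChain n u w

/-- The edit distance `d̂(v,w)`: the minimal number of edits transforming `v` into `w`. -/
def editDist (v w : List A) : ℕ := sInf {n | EditChain n v w}

/-- A mistake function: a nondecreasing `g : ℕ → ℕ` with `g n / n → 0`. -/
def MistakeFunction (g : ℕ → ℕ) : Prop :=
  Monotone g ∧ Tendsto (fun n => (g n : ℝ) / n) atTop (nhds 0)

/-- `L` is edit approachable by `G`. -/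
def EditApproachable (L G : Set (List A)) : Prop :=
  ∃ g : ℕ → ℕ, MistakeFunction g ∧ ∀ w ∈ L, ∃ v ∈ G, editDist v w ≤ g w.length

/-- `G ⊆ L` has (W)-specification with gap length `τ`. -/
def HasSpecW (L G : Set (List A)) (τ : ℕ) : Prop :=
  ∀ v ∈ G, ∀ w ∈ G, ∃ u ∈ L, u.length ≤ τ ∧ v ++ u ++ w ∈ G

/-- The (non-strict) lexicographic order on sequences. -/
def LexLe [LinearOrder A] (u v : SeqSpace A) : Prop :=
  u = v ∨ ∃ n, (∀ i < n, u i = v i) ∧ u n < v n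

end SeqSpace

namespace SeqSpace

variable {A : Type*}

theorem dist_le_exp_iff (u v : SeqSpace A) (m : ℕ) :
    dist u v ≤ Real.exp (-(m : ℝ)) ↔ ∀ i < m, u i = v i := by
  change sdist u v ≤ _ ↔ _
  by_cases h : u = v
  · subst h
    simp [sdist, (Real.exp_pos _).le]
  · rw [sdist, if_neg h, Real.exp_le_exp, neg_le_neg_iff, Nat.cast_le]
    constructor
    · intro hm i hi
      by_contra hne
      have : lcp u v ≤ i := Nat.sInf_le hne
      omega
    · intro hm
      by_contra hlt
      exact lcp_mem h (hm _ (by omega))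

theorem shift_iter (n : ℕ) (x : SeqSpace A) (i : ℕ) : (shift^[n] x) i = x (n + i) := by
  induction n generalizing x with
  | zero => simp
  | succ n ih =>
    rw [Function.iterate_succ_apply, ih]
    show x (n + i + 1) = _
    congr 1; omega

theorem shift_iter_mem {Y : Set (SeqSpace A)} (hY : shift '' Y ⊆ Y) (n : ℕ) {x : SeqSpace A}
    (hx : x ∈ Y) : shift^[n] x ∈ Y := by
  induction n with
  | zero => exact hx
  | succ n ih =>
    rw [Function.iterate_succ_apply']
    exact hY ⟨_, ih, rfl⟩

/-- Prefix of length `n`. -/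
def pre (n : ℕ) (x : SeqSpace A) : Fin n → A := fun i => x i

theorem pre_eq_iff (n : ℕ) (x y : SeqSpace A) : pre n x = pre n y ↔ ∀ i < n, x i = y i := by
  constructor
  · intro h i hi
    exact congrFun h ⟨i, hi⟩
  · intro h
    funext i
    exact h i i.2

/-- Prepend a letter. -/
def cons (a : A) (x : SeqSpace A) : SeqSpace A := fun n => Nat.casesOn n a x

theorem cons_shift (x : SeqSpace A) : cons (x 0) (shift x) = x := by
  funext n
  cases n <;> rfl

theorem cons_lipschitz (a : A) : LipschitzWith 1 (cons a) := by
  refine LipschitzWith.of_dist_le_mul fun x y => ?_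
  simp only [NNReal.coe_one, one_mul]
  by_cases h : x = y
  · simp [h]
  · have h1 : dist x y = Real.exp (-(lcp x y : ℝ)) := by
      change sdist x y = _
      rw [sdist, if_neg h]
    rw [h1, dist_le_exp_iff]
    have h2 := (dist_le_exp_iff x y _).1 h1.le
    intro i hi
    cases i with
    | zero => rfl
    | succ i => exact h2 i (by omega)

theorem dimH_preimage_shift [Finite A] (Y : Set (SeqSpace A)) :
    dimH (shift ⁻¹' Y) ≤ dimH Y := by
  have h : shift ⁻¹' Y ⊆ ⋃ a : A, cons a '' Y := by
    intro x hx
    exact mem_iUnion.2 ⟨x 0, shift x, hx, cons_shift x⟩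
  refine (dimH_mono h).trans ?_
  rw [dimH_iUnion]
  exact iSup_le fun a => (cons_lipschitz a).dimH_image_le Y

theorem dimH_preimage_shift_iter [Finite A] (n : ℕ) (Y : Set (SeqSpace A)) :
    dimH (shift^[n] ⁻¹' Y) ≤ dimH Y := by
  induction n with
  | zero => simp
  | succ n ih =>
    rw [Function.iterate_succ, preimage_comp]
    exact (dimH_preimage_shift _).trans ih

/-- Points that return infinitely often to their own cylinder of length `K`. -/
def ret (K : ℕ) (Y : Set (SeqSpace A)) : Set (SeqSpace A) :=
  {x ∈ Y | ∃ᶠ n in atTop, pre K (shift^[n] x) = pre K x}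

theorem dimH_le_ret [Finite A] (K m : ℕ) : ∀ Y : Set (SeqSpace A), shift '' Y ⊆ Y →
    (pre K '' Y).ncard ≤ m → dimH Y ≤ dimH (ret K Y) := by
  induction m with
  | zero =>
    intro Y _ hc
    have h0 : (pre K '' Y).ncard = 0 := by omega
    rw [Set.ncard_eq_zero (Set.toFinite _), image_eq_empty] at h0
    subst h0
    simp
  | succ m ih =>
    intro Y hY hc
    let Z : (Fin K → A) → Set (SeqSpace A) := fun u => {x ∈ Y | ∀ n, pre K (shift^[n] x) ≠ u}
    have hcov : Y ⊆ ret K Y ∪ ⋃ p : (pre K '' Y) × ℕ, shift^[p.2] ⁻¹' (Z p.1) := by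
      intro x hx
      by_cases hr : ∃ᶠ n in atTop, pre K (shift^[n] x) = pre K x
      · exact Or.inl ⟨hx, hr⟩
      · right
        rw [not_frequently, eventually_atTop] at hr
        obtain ⟨N, hN⟩ := hr
        refine mem_iUnion.2 ⟨(⟨pre K x, x, hx, rfl⟩, N), shift_iter_mem hY N hx, fun n => ?_⟩
        have := hN (n + N) (by omega)
        rwa [Function.iterate_add_apply] at this
    refine (dimH_mono hcov).trans ?_
    rw [dimH_union, dimH_iUnion]
    refine max_le le_rfl (iSup_le fun p => (dimH_preimage_shift_iter _ _).trans ?_)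
    obtain ⟨⟨u, hu⟩, N⟩ := p
    have hZinv : shift '' Z u ⊆ Z u := by
      rintro _ ⟨x, hx, rfl⟩
      refine ⟨hY ⟨x, hx.1, rfl⟩, fun n => ?_⟩
      have := hx.2 (n + 1)
      rwa [Function.iterate_succ_apply] at this
    have hlt : (pre K '' Z u).ncard < (pre K '' Y).ncard := by
      refine Set.ncard_lt_ncard ⟨image_mono fun x hx => hx.1, fun hsub => ?_⟩ (Set.toFinite _)
      obtain ⟨x, hx, hxu⟩ := hsub hu
      exact hx.2 0 hxu
    refine (ih (Z u) hZinv (by omega)).trans (dimH_mono ?_)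
    exact fun x hx => ⟨hx.1.1, hx.2⟩

theorem ncard_words (X : Set (SeqSpace A)) (hX : shift '' X ⊆ X) (n : ℕ) :
    (wordsOfLen (language X) n).ncard = (pre n '' X).ncard := by
  have : wordsOfLen (language X) n = List.ofFn '' (pre n '' X) := by
    ext w
    constructor
    · rintro ⟨⟨x, hx, k, hk⟩, hl⟩
      refine ⟨_, ⟨shift^[k] x, shift_iter_mem hX k hx, rfl⟩, ?_⟩
      apply List.ext_getElem
      · simp [hl]
      · intro i h1 h2
        simp only [List.getElem_ofFn, pre]
        rw [shift_iter]
        exact hk i h2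
    · rintro ⟨_, ⟨x, hx, rfl⟩, rfl⟩
      refine ⟨⟨x, hx, 0, fun i hi => ?_⟩, by simp⟩
      simp [pre]
  rw [this, Set.ncard_image_of_injective _ List.ofFn_injective]

theorem dimH_le_entropy [Finite A] (X : Set (SeqSpace A)) (h : ℝ)
    (hent : Tendsto (fun n => Real.log ((pre n '' X).ncard) / n) atTop (nhds h)) :
    dimH X ≤ ENNReal.ofReal h := by
  have h0 : 0 ≤ h := ge_of_tendsto' hent fun n =>
    div_nonneg (Real.log_natCast_nonneg _) (Nat.cast_nonneg _)
  refine ENNReal.le_of_forall_pos_le_add fun ε hε _ => ?_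
  obtain ⟨s, hs⟩ : ∃ s : ℝ, s = h + ε := ⟨_, rfl⟩
  have hs0 : 0 ≤ s := by rw [hs]; positivity
  have hse : ENNReal.ofReal h + ε = ((s.toNNReal : ℝ≥0) : ℝ≥0∞) := by
    change _ = ENNReal.ofReal s
    rw [hs, ENNReal.ofReal_add h0 (NNReal.coe_nonneg ε)]
    simp
  rw [hse]
  borelize (SeqSpace A)
  apply dimH_le_of_hausdorffMeasure_ne_top
  rw [Real.coe_toNNReal s hs0]
  letI : ∀ n : ℕ, Fintype (pre n '' X) := fun n => Fintype.ofFinite _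
  have hdiam : ∀ (n : ℕ) (u : pre n '' X),
      Metric.ediam {x : SeqSpace A | pre n x = u} ≤ ENNReal.ofReal (Real.exp (-(n : ℝ))) := by
    intro n u
    refine Metric.ediam_le fun x hx y hy => ?_
    rw [edist_dist]
    refine ENNReal.ofReal_le_ofReal ((dist_le_exp_iff _ _ _).2 ((pre_eq_iff _ _ _).1 ?_))
    rw [mem_setOf_eq] at hx hy
    rw [hx, hy]
  have hle := Measure.hausdorffMeasure_le_liminf_sum (β := ℕ) (ι := fun n => (pre n '' X))
    s X (l := atTop) (fun n : ℕ => ENNReal.ofReal (Real.exp (-(n : ℝ))))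
    (by
      rw [← ENNReal.ofReal_zero]
      refine ENNReal.tendsto_ofReal ?_
      exact Real.tendsto_exp_atBot.comp (tendsto_neg_atTop_atBot.comp tendsto_natCast_atTop_atTop))
    (fun n u => {x | pre n x = u}) (Eventually.of_forall hdiam)
    (Eventually.of_forall fun n x hx => mem_iUnion.2 ⟨⟨pre n x, x, hx, rfl⟩, rfl⟩)
  have hev : ∀ᶠ n : ℕ in atTop,
      ∑ u : (pre n '' X), Metric.ediam {x : SeqSpace A | pre n x = u} ^ s ≤ 1 := by
    have h1 : ∀ᶠ n : ℕ in atTop, Real.log ((pre n '' X).ncard) / n < s :=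
      hent.eventually_lt_const (by rw [hs]; simpa using hε)
    filter_upwards [h1, eventually_gt_atTop 0] with n hn hn0
    have hn0' : (0 : ℝ) < n := by exact_mod_cast hn0
    rw [div_lt_iff₀ hn0'] at hn
    have hcard : ((pre n '' X).ncard : ℝ) ≤ Real.exp (s * n) :=
      (Real.le_exp_log _).trans (Real.exp_le_exp.2 hn.le)
    calc ∑ u : (pre n '' X), Metric.ediam {x : SeqSpace A | pre n x = u} ^ s
        ≤ ∑ u : (pre n '' X), ENNReal.ofReal (Real.exp (-(n : ℝ))) ^ s :=
          Finset.sum_le_sum fun u _ => ENNReal.rpow_le_rpow (hdiam n u) hs0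
      _ = ENNReal.ofReal ((pre n '' X).ncard * Real.exp (-(s * n))) := by
          rw [Finset.sum_const, Finset.card_univ, ← Nat.card_eq_fintype_card,
            ENNReal.ofReal_rpow_of_pos (Real.exp_pos _), nsmul_eq_mul,
            ENNReal.ofReal_mul (Nat.cast_nonneg _), ENNReal.ofReal_natCast, ← Real.exp_mul,
            Nat.card_coe_set_eq]
          congr 3
          ring
      _ ≤ ENNReal.ofReal 1 := by
          refine ENNReal.ofReal_le_ofReal ?_
          rw [Real.exp_neg, ← div_eq_mul_inv, div_le_one (Real.exp_pos _)]
          exact hcard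
      _ = 1 := ENNReal.ofReal_one
  have : liminf (fun n => ∑ u : (pre n '' X), Metric.ediam {x : SeqSpace A | pre n x = u} ^ s)
      atTop ≤ 1 := by
    refine (liminf_le_liminf hev).trans ?_
    rw [liminf_const]
  exact ((hle.trans this).trans_lt ENNReal.one_lt_top).ne

theorem cover_len (s : ℝ) (hs : 0 < s) (T : Set (SeqSpace A))
    (hT : Metric.ediam T ≤ ENNReal.ofReal (Real.exp (-1))) (δ : ℝ≥0∞) (hδ : 0 < δ) :
    ∃ m : ℕ, 1 ≤ m ∧ (∀ x ∈ T, ∀ y ∈ T, pre m x = pre m y) ∧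
      ENNReal.ofReal (Real.exp (-(s * m))) ≤
        ENNReal.ofReal (Real.exp s) * (⨆ _ : T.Nonempty, Metric.ediam T ^ s) + δ := by
  by_cases h0 : Metric.ediam T = 0
  · have hlim : Tendsto (fun m : ℕ => ENNReal.ofReal (Real.exp (-(s * m)))) atTop (nhds 0) := by
      rw [← ENNReal.ofReal_zero]
      refine ENNReal.tendsto_ofReal ?_
      exact Real.tendsto_exp_atBot.comp (tendsto_neg_atTop_atBot.comp
        (tendsto_natCast_atTop_atTop.const_mul_atTop hs))
    obtain ⟨m, hm, hm1⟩ := ((hlim.eventually_lt_const hδ).and (eventually_ge_atTop 1)).exists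
    refine ⟨m, hm1, fun x hx y hy => ?_, hm.le.trans le_add_self⟩
    rw [Metric.ediam_eq_zero_iff] at h0
    rw [h0 hx hy]
  · have hne : T.Nonempty := by
      rw [nonempty_iff_ne_empty]
      rintro rfl
      exact h0 Metric.ediam_empty
    have htop : Metric.ediam T ≠ ∞ := (hT.trans_lt ENNReal.ofReal_lt_top).ne
    obtain ⟨d, hd⟩ : ∃ d : ℝ, d = (Metric.ediam T).toReal := ⟨_, rfl⟩
    have hdT : Metric.ediam T = ENNReal.ofReal d := by rw [hd, ENNReal.ofReal_toReal htop]
    have hd0 : 0 < d := by rw [hd]; exact ENNReal.toReal_pos h0 htop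
    have hd1 : d ≤ Real.exp (-1) := by
      rw [hdT] at hT
      exact (ENNReal.ofReal_le_ofReal_iff (Real.exp_pos _).le).1 hT
    have hlog : 1 ≤ -Real.log d := by
      have := (Real.log_le_iff_le_exp hd0).2 hd1
      linarith
    refine ⟨⌊-Real.log d⌋₊, Nat.le_floor (by simpa using hlog), fun x hx y hy => ?_, ?_⟩
    · rw [pre_eq_iff, ← dist_le_exp_iff]
      have h1 : edist x y ≤ ENNReal.ofReal d := hdT ▸ Metric.edist_le_ediam_of_mem hx hy
      rw [edist_dist, ENNReal.ofReal_le_ofReal_iff hd0.le] at h1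
      refine h1.trans ?_
      rw [← Real.log_le_iff_le_exp hd0]
      have := Nat.floor_le (show 0 ≤ -Real.log d by linarith)
      linarith
    · refine le_trans ?_ le_self_add
      rw [iSup_pos hne, hdT, ENNReal.ofReal_rpow_of_pos hd0, ← ENNReal.ofReal_mul (Real.exp_pos _).le]
      refine ENNReal.ofReal_le_ofReal ?_
      rw [Real.rpow_def_of_pos hd0, ← Real.exp_add, Real.exp_le_exp]
      have := Nat.lt_floor_add_one (-Real.log d)
      nlinarith

theorem ncard_step [Finite A] (X : Set (SeqSpace A)) (hX : shift '' X ⊆ X) (T : Set (SeqSpace A))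
    (m N : ℕ) (hmN : m ≤ N) (hT : ∀ x ∈ T, ∀ y ∈ T, pre m x = pre m y) :
    (pre N '' {x ∈ X | ∃ y ∈ T, pre m x = pre m y}).ncard ≤ (pre (N - m) '' X).ncard := by
  rcases T.eq_empty_or_nonempty with rfl | ⟨y, hy⟩
  · simp
  let f : (Fin (N - m) → A) → (Fin N → A) := fun v j =>
    if hj : (j : ℕ) < m then y j else v ⟨j - m, by omega⟩
  refine le_trans (Set.ncard_le_ncard (t := f '' (pre (N - m) '' X)) ?_ (Set.toFinite _))
    (Set.ncard_image_le (Set.toFinite _))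
  rintro _ ⟨x, ⟨hx, z, hz, hxz⟩, rfl⟩
  refine ⟨_, ⟨shift^[m] x, shift_iter_mem hX m hx, rfl⟩, ?_⟩
  rw [hT z hz y hy, pre_eq_iff] at hxz
  funext j
  by_cases hj : (j : ℕ) < m
  · simp only [f, dif_pos hj, pre]
    exact (hxz j hj).symm
  · simp only [f, dif_neg hj, pre]
    rw [shift_iter]
    congr 1
    omega

theorem growth (a : ℕ → ℝ) (s : ℝ) (hs : 0 ≤ s) (F : Finset ℕ) (m : ℕ → ℕ) (hm : ∀ i, 1 ≤ m i)
    (hsum : ∑ i ∈ F, Real.exp (-(s * m i)) ≤ 1) (M : ℕ) (hM : ∀ i ∈ F, m i ≤ M)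
    (ha : ∀ N, M ≤ N → a N ≤ ∑ i ∈ F, a (N - m i)) :
    ∃ C : ℝ, 1 ≤ C ∧ ∀ N, a N ≤ C * Real.exp (s * N) := by
  have hS : 0 ≤ ∑ k ∈ Finset.range M, |a k| := Finset.sum_nonneg fun k _ => abs_nonneg _
  obtain ⟨C, hC⟩ : ∃ C : ℝ, C = 1 + ∑ k ∈ Finset.range M, |a k| := ⟨_, rfl⟩
  refine ⟨C, by linarith, fun N => ?_⟩
  induction N using Nat.strong_induction_on with
  | _ N ih =>
  by_cases hN : N < M
  · have h1 : |a N| ≤ ∑ k ∈ Finset.range M, |a k| :=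
      Finset.single_le_sum (f := fun k => |a k|) (fun k _ => abs_nonneg _) (Finset.mem_range.2 hN)
    have h2 : 1 ≤ Real.exp (s * N) := Real.one_le_exp (by positivity)
    have h3 := le_abs_self (a N)
    nlinarith
  · push Not at hN
    have hb : ∀ i ∈ F, a (N - m i) ≤ C * Real.exp (s * N) * Real.exp (-(s * m i)) := by
      intro i hi
      have hi1 := hm i
      have hi2 := hM i hi
      refine (ih (N - m i) (by omega)).trans (le_of_eq ?_)
      rw [mul_assoc, ← Real.exp_add, Nat.cast_sub (by omega)]
      congr 2
      ring
    calc a N ≤ ∑ i ∈ F, a (N - m i) := ha N hN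
      _ ≤ ∑ i ∈ F, C * Real.exp (s * N) * Real.exp (-(s * m i)) := Finset.sum_le_sum hb
      _ = C * Real.exp (s * N) * ∑ i ∈ F, Real.exp (-(s * m i)) := by rw [Finset.mul_sum]
      _ ≤ C * Real.exp (s * N) * 1 := by
          have : 0 ≤ C := by linarith
          gcongr
      _ = C * Real.exp (s * N) := mul_one _

theorem entropy_le_dimH [Finite A] (X : Set (SeqSpace A)) (hc : IsCompact X)
    (hX : shift '' X ⊆ X) (h : ℝ)
    (hent : Tendsto (fun n => Real.log ((pre n '' X).ncard) / n) atTop (nhds h)) :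
    ENNReal.ofReal h ≤ dimH X := by
  by_contra hlt
  push Not at hlt
  obtain ⟨s, hs1, hs2⟩ := ENNReal.lt_iff_exists_nnreal_btwn.1 hlt
  have hs0 : (0 : ℝ) < s := by
    have : (0 : ℝ≥0∞) < s := (zero_le).trans_lt hs1
    exact_mod_cast this
  have hsh : (s : ℝ) < h := by
    rw [ENNReal.lt_ofReal_iff_toReal_lt ENNReal.coe_ne_top] at hs2
    simpa using hs2
  borelize (SeqSpace A)
  have hz := hausdorffMeasure_of_dimH_lt hs1
  rw [Measure.hausdorffMeasure_apply] at hz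
  have hr : (0 : ℝ≥0∞) < ENNReal.ofReal (Real.exp (-1)) := ENNReal.ofReal_pos.2 (Real.exp_pos _)
  have hz1 := le_iSup₂ (f := fun (r : ℝ≥0∞) (_ : 0 < r) =>
    ⨅ (t : ℕ → Set (SeqSpace A)) (_ : X ⊆ ⋃ n, t n) (_ : ∀ n, Metric.ediam (t n) ≤ r),
          ∑' n, ⨆ _ : (t n).Nonempty, Metric.ediam (t n) ^ (s : ℝ)) _ hr
  rw [hz] at hz1
  have hpos : (0 : ℝ≥0∞) < ENNReal.ofReal (Real.exp (-s) / 2) :=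
    ENNReal.ofReal_pos.2 (by positivity)
  have hz2 := hz1.trans_lt hpos
  simp only [iInf_lt_iff] at hz2
  obtain ⟨t, htX, htd, htsum⟩ := hz2
  obtain ⟨δ, hδ0, hδ⟩ := ENNReal.exists_pos_sum_of_countable
    (ε := ENNReal.ofReal (1 / 2)) (by simp) ℕ
  choose m hm1 hmT hms using fun n => cover_len s hs0 (t n) (htd n) (δ n)
    (by exact_mod_cast hδ0 n)
  have htot : ∑' n, ENNReal.ofReal (Real.exp (-(s * m n))) ≤ 1 := by
    calc ∑' n, ENNReal.ofReal (Real.exp (-(s * m n)))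
        ≤ ∑' n, (ENNReal.ofReal (Real.exp s) *
          (⨆ _ : (t n).Nonempty, Metric.ediam (t n) ^ (s : ℝ)) + δ n) := ENNReal.tsum_le_tsum hms
      _ = ENNReal.ofReal (Real.exp s) *
          (∑' n, ⨆ _ : (t n).Nonempty, Metric.ediam (t n) ^ (s : ℝ)) + ∑' n, (δ n : ℝ≥0∞) := by
          rw [ENNReal.tsum_add, ENNReal.tsum_mul_left]
      _ ≤ ENNReal.ofReal (Real.exp s) * ENNReal.ofReal (Real.exp (-s) / 2) +
          ENNReal.ofReal (1 / 2) := by gcongr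
      _ = 1 := by
          rw [← ENNReal.ofReal_mul (Real.exp_pos _).le, ← ENNReal.ofReal_add (by positivity)
            (by norm_num), ← mul_div_assoc, ← Real.exp_add]
          norm_num
  let U : ℕ → Set (SeqSpace A) := fun n => {x | ∃ y ∈ t n, pre (m n) x = pre (m n) y}
  have hUo : ∀ n, IsOpen (U n) := by
    intro n
    rw [Metric.isOpen_iff]
    rintro x ⟨y, hy, hxy⟩
    refine ⟨Real.exp (-(m n : ℝ)), Real.exp_pos _, fun z hz => ⟨y, hy, ?_⟩⟩
    rw [← hxy, pre_eq_iff, ← dist_le_exp_iff]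
    exact (Metric.mem_ball.1 hz).le
  have hUX : X ⊆ ⋃ n, U n := fun x hx => by
    obtain ⟨n, hn⟩ := mem_iUnion.1 (htX hx)
    exact mem_iUnion.2 ⟨n, x, hn, rfl⟩
  obtain ⟨F, hF⟩ := hc.elim_finite_subcover U hUo hUX
  have hsumF : ∑ i ∈ F, Real.exp (-(s * m i)) ≤ 1 := by
    have h1 := (ENNReal.sum_le_tsum F).trans htot
    rw [← ENNReal.ofReal_sum_of_nonneg (fun i _ => (Real.exp_pos _).le), ENNReal.ofReal_le_one] at h1
    exact h1
  obtain ⟨C, hC1, hC⟩ := growth (fun N => ((pre N '' X).ncard : ℝ)) s hs0.le F m hm1 hsumF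
    (F.sup m) (fun i hi => Finset.le_sup hi) (by
      intro N hN
      have hsub : pre N '' X ⊆ ⋃ i ∈ F, pre N '' {x ∈ X | ∃ y ∈ t i, pre (m i) x = pre (m i) y} := by
        rintro _ ⟨x, hx, rfl⟩
        obtain ⟨i, hi, hxi⟩ := mem_iUnion₂.1 (hF hx)
        exact mem_iUnion₂.2 ⟨i, hi, x, ⟨hx, hxi⟩, rfl⟩
      have h1 := (Set.ncard_le_ncard hsub (Set.toFinite _)).trans (Finset.set_ncard_biUnion_le _ _)
      have h2 := h1.trans (Finset.sum_le_sum fun i hi =>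
        ncard_step X hX (t i) (m i) N ((Finset.le_sup hi).trans hN) (hmT i))
      exact_mod_cast h2)
  have hlim : Tendsto (fun n : ℕ => Real.log C / n + s) atTop (nhds (0 + s)) :=
    (tendsto_const_div_atTop_nhds_zero_nat _).add_const _
  rw [zero_add] at hlim
  refine absurd (le_of_tendsto_of_tendsto hent hlim ?_) (not_le.2 hsh)
  filter_upwards [eventually_gt_atTop 0] with n hn
  have hn' : (0 : ℝ) < n := by exact_mod_cast hn
  rw [div_add' _ _ _ hn'.ne']
  refine div_le_div_of_nonneg_right ?_ hn'.le
  rcases Nat.eq_zero_or_pos (pre n '' X).ncard with h0 | h0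
  · rw [h0]
    have := Real.log_nonneg hC1
    simp
    positivity
  · have h3 := Real.log_le_log (by exact_mod_cast h0) (hC n)
    rwa [Real.log_mul (by positivity) (Real.exp_pos _).ne', Real.log_exp] at h3

end SeqSpace

open SeqSpace

/-- **Theorem 1.4 C1.** If a subshift `X` has non-uniform structure (some `G ⊆ 𝓛(X)` has
(W)-specification and `𝓛(X)` is edit approachable by `G`) and `ψ : ℕ → (0,∞)` has
`liminf ψ(n) > 0`, then `dim_H R(ψ) = h_top(X)`. -/
theorem dimH_recSet_eq_entropy_of_liminf_pos
    {A : Type*} [Finite A] (X : Set (SeqSpace A))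
    (hXcomp : IsCompact X) (hXinv : shift '' X ⊆ X)
    (G : Set (List A)) (hG : G ⊆ language X) (τ : ℕ)
    (hspec : HasSpecW (language X) G τ)
    (happ : EditApproachable (language X) G)
    (h : ℝ)
    (hent : Tendsto (fun n => Real.log ((wordsOfLen (language X) n).ncard) / n)
      atTop (nhds h))
    (ψ : ℕ → ℝ) (hψpos : ∀ n, 0 < ψ n)
    (hliminf : ∃ ε > 0, ∀ᶠ n in atTop, ε ≤ ψ n) :
    dimH (recSet X ψ) = ENNReal.ofReal h := by
  have hent' : Tendsto (fun n => Real.log ((pre n '' X).ncard) / n) atTop (nhds h) := by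
    simpa only [ncard_words X hXinv] using hent
  refine le_antisymm ((dimH_mono fun x hx => hx.1).trans (dimH_le_entropy X h hent')) ?_
  obtain ⟨ε, hε, hev⟩ := hliminf
  obtain ⟨K, hK⟩ : ∃ K : ℕ, Real.exp (-(K : ℝ)) < ε := by
    have hl : Tendsto (fun n : ℕ => Real.exp (-(n : ℝ))) atTop (nhds 0) :=
      Real.tendsto_exp_atBot.comp (tendsto_neg_atTop_atBot.comp tendsto_natCast_atTop_atTop)
    exact (hl.eventually_lt_const hε).exists
  refine (entropy_le_dimH X hXcomp hXinv h hent').trans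
    ((dimH_le_ret K _ X hXinv le_rfl).trans (dimH_mono ?_))
  rintro x ⟨hx, hfr⟩
  refine ⟨hx, (hfr.and_eventually hev).mono ?_⟩
  rintro n ⟨h1, h2⟩
  exact (((dist_le_exp_iff _ _ _).2 ((pre_eq_iff _ _ _).1 h1)).trans_lt hK).trans_le h2
end
end

section
/- Let β > 1 and let Σ_β be the β-shift, with shift map σ and the metric d(u,v) = e^{-|u∧v|}. If ψ : ℕ → (0,∞) is nonincreasing, then the Hausdorff dimension of R(ψ) = {x ∈ Σ_β : d(σ^n x, x) < ψ(n) for infinitely many n} equals h/(1+b), where h = h_top(Σ_β) and b = liminf_{n→∞} (−log ψ(n))/n (with the convention h/(1+b) = 0 when b = ∞). -/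
open Filter MeasureTheory Set
open scoped ENNReal NNReal

noncomputable section

open SeqSpace

/-- The β-shift determined by the greedy β-expansion `w` of `1`:
all sequences `x` with `σ^j x ≼ w` for all `j ≥ 1`. -/
def betaShift (β : ℝ) (w : SeqSpace (Fin ⌈β⌉₊)) : Set (SeqSpace (Fin ⌈β⌉₊)) :=
  {x | ∀ j : ℕ, 1 ≤ j → LexLe (shift^[j] x) w}

theorem bs_shift_iter {A : Type*} (x : SeqSpace A) (n i : ℕ) : (shift^[n] x) i = x (n + i) := by
  induction n generalizing x with
  | zero => simp
  | succ n ih =>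
    rw [Function.iterate_succ_apply, ih]
    show x (n + i + 1) = _
    congr 1; omega

theorem bs_agree_of_dist_lt {A : Type*} {u v : SeqSpace A} {t : ℝ}
    (h : dist u v < Real.exp (-t)) (i : ℕ) (hi : (i : ℝ) ≤ t) : u i = v i := by
  by_cases huv : u = v
  · rw [huv]
  · have h1 : dist u v = Real.exp (-(lcp u v : ℝ)) := by
      show sdist u v = _
      rw [sdist, if_neg huv]
    rw [h1, Real.exp_lt_exp] at h
    have h2 : i < lcp u v := by
      have : (i : ℝ) < lcp u v := by linarith
      exact_mod_cast this
    have := Nat.notMem_of_lt_sInf h2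
    simpa using this

theorem bs_dist_le_of_agree {A : Type*} {u v : SeqSpace A} {t : ℝ}
    (h : ∀ i : ℕ, (i : ℝ) < t → u i = v i) : dist u v ≤ Real.exp (-t) := by
  show sdist u v ≤ _
  by_cases huv : u = v
  · rw [huv, sdist_self']; positivity
  · rw [sdist, if_neg huv, Real.exp_le_exp]
    have h2 := lcp_mem huv
    by_contra hcon
    exact h2 (h _ (by linarith))

theorem bs_finite_words {A : Type*} [Finite A] (D : Set (List A)) (n : ℕ) :
    (wordsOfLen D n).Finite :=
  (List.finite_length_eq A n).subset fun _ hw => hw.2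

theorem bs_upper {A : Type*} [Finite A] (X : Set (SeqSpace A)) (h : ℝ)
    (hent : Tendsto (fun n => Real.log ((wordsOfLen (language X) n).ncard) / n)
      atTop (nhds h)) (ψ : ℕ → ℝ) (B s : ℝ) (hB : 0 ≤ B) (hs : 0 < s)
    (hsB : h < s * (1 + B)) (hψ : ∀ᶠ n : ℕ in atTop, B = 0 ∨ ψ n ≤ Real.exp (-(B * n))) :
    dimH (recSet X ψ) ≤ ENNReal.ofReal s := by
  borelize (SeqSpace A)
  obtain ⟨g, hg1, hg2⟩ := exists_between hsB
  set δ : ℝ := s * (1 + B) - g with hδ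
  have hδ0 : 0 < δ := by linarith
  -- counting
  have hcount : ∀ᶠ n : ℕ in atTop,
      ((wordsOfLen (language X) n).ncard : ℝ) ≤ Real.exp (n * g) := by
    filter_upwards [hent.eventually_lt_const hg1, eventually_gt_atTop 0] with n hn hn0
    have hn0' : (0 : ℝ) < n := by exact_mod_cast hn0
    rw [div_lt_iff₀ hn0'] at hn
    rcases Nat.eq_zero_or_pos (wordsOfLen (language X) n).ncard with h0 | h0
    · rw [h0]; simp; positivity
    · rw [← Real.log_le_iff_le_exp (by exact_mod_cast h0)]
      linarith
  let ι : ℕ → Type _ := fun n0 => Σ k : ℕ, (wordsOfLen (language X) (n0 + k))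
  have hc : ∀ n k, Finite (wordsOfLen (language X) (n + k)) := fun n k =>
    (bs_finite_words (language X) (n + k)).to_subtype
  have : ∀ n, Countable (ι n) := fun n => by
    show Countable (Σ k : ℕ, (wordsOfLen (language X) (n + k)))
    infer_instance
  let t : ∀ n0 : ℕ, ι n0 → Set (SeqSpace A) := fun n0 p =>
    {x | x ∈ cyl p.2.1 ∧ ∀ i : ℕ, (i : ℝ) < B * ((n0 + p.1 : ℕ) : ℝ) → x (n0 + p.1 + i) = x i}
  have hdiam : ∀ n0 : ℕ, 1 ≤ n0 → ∀ p : ι n0,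
      Metric.ediam (t n0 p) ≤ ENNReal.ofReal (Real.exp (-((1 + B) * ((n0 + p.1 : ℕ) : ℝ)))) := by
    intro n0 hn0 p
    refine Metric.ediam_le fun x hx y hy => ?_
    rw [edist_dist]
    refine ENNReal.ofReal_le_ofReal (bs_dist_le_of_agree ?_)
    have hlen : p.2.1.length = n0 + p.1 := p.2.2.2
    intro i
    induction i using Nat.strong_induction_on with
    | _ i ih =>
      intro hi
      by_cases hin : i < n0 + p.1
      · have e1 := hx.1 i (by omega)
        have e2 := hy.1 i (by omega)
        rw [zero_add] at e1 e2
        rw [e1, e2]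
      · obtain ⟨m, rfl⟩ := Nat.exists_eq_add_of_le (not_lt.mp hin)
        have hm : (m : ℝ) < B * ((n0 + p.1 : ℕ) : ℝ) := by
          push_cast at hi ⊢; linarith
        rw [hx.2 m hm, hy.2 m hm]
        refine ih m (by omega) ?_
        have : (0 : ℝ) ≤ ((n0 + p.1 : ℕ) : ℝ) := by positivity
        linarith
  have hmain : μH[s] (recSet X ψ) ≤ ∑' k : ℕ, ENNReal.ofReal (Real.exp (-δ) ^ k) := by
    refine (Measure.hausdorffMeasure_le_liminf_tsum (l := atTop) s (recSet X ψ)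
      (fun n0 : ℕ => ENNReal.ofReal (Real.exp (-(n0 : ℝ)))) ?_ t ?_ ?_).trans ?_
    · rw [← ENNReal.ofReal_zero]
      refine (ENNReal.continuous_ofReal.tendsto 0).comp ?_
      exact Real.tendsto_exp_neg_atTop_nhds_zero.comp tendsto_natCast_atTop_atTop
    · filter_upwards [eventually_ge_atTop 1] with n0 hn0 p
      refine (hdiam n0 hn0 p).trans (ENNReal.ofReal_le_ofReal (Real.exp_le_exp.mpr ?_))
      push_cast
      have h1 : (0 : ℝ) ≤ n0 := by positivity
      have h2 : (0 : ℝ) ≤ p.1 := by positivity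
      nlinarith
    · obtain ⟨N, hN⟩ := eventually_atTop.mp hψ
      filter_upwards [eventually_ge_atTop N] with n0 hn0 x hx
      obtain ⟨n, hn, hd⟩ := (frequently_atTop.mp hx.2) n0
      obtain ⟨k, rfl⟩ := Nat.exists_eq_add_of_le hn
      rw [mem_iUnion]
      refine ⟨⟨k, ⟨List.ofFn (fun i : Fin (n0 + k) => x i), ⟨x, hx.1, 0, ?_⟩, by simp⟩⟩, ?_, ?_⟩
      · intro i hi; simp
      · intro i hi; simp
      · intro i hi
        rcases hN (n0 + k) (by omega) with h0 | h0
        · rw [h0, zero_mul] at hi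
          exact absurd hi (not_lt.mpr (by positivity))
        · have := bs_agree_of_dist_lt (hd.trans_le h0) i hi.le
          rwa [bs_shift_iter] at this
    · obtain ⟨N, hN⟩ := eventually_atTop.mp hcount
      refine liminf_le_of_frequently_le' (Eventually.frequently ?_)
      filter_upwards [eventually_ge_atTop N, eventually_ge_atTop 1] with n0 hn0 hn1
      show ∑' i : (Σ k : ℕ, (wordsOfLen (language X) (n0 + k))), _ ≤ _
      rw [ENNReal.tsum_sigma']
      refine ENNReal.tsum_le_tsum fun k => ?_
      let _ : Fintype (wordsOfLen (language X) (n0 + k)) := Fintype.ofFinite _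
      rw [tsum_fintype]
      have hb : ∀ v : wordsOfLen (language X) (n0 + k),
          Metric.ediam (t n0 ⟨k, v⟩) ^ s ≤
            ENNReal.ofReal (Real.exp (-(s * (1 + B) * ((n0 + k : ℕ) : ℝ)))) := by
        intro v
        refine (ENNReal.rpow_le_rpow (hdiam n0 hn1 ⟨k, v⟩) hs.le).trans ?_
        rw [ENNReal.ofReal_rpow_of_nonneg (by positivity) hs.le, ← Real.exp_mul]
        refine ENNReal.ofReal_le_ofReal (Real.exp_le_exp.mpr (le_of_eq ?_))
        simp only
        ring
      refine (Finset.sum_le_card_nsmul _ _ _ fun v _ => hb v).trans ?_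
      have hcard : (Finset.univ : Finset (wordsOfLen (language X) (n0 + k))).card
          = (wordsOfLen (language X) (n0 + k)).ncard := by
        rw [Finset.card_univ, ← Nat.card_eq_fintype_card]; rfl
      rw [hcard, nsmul_eq_mul, ← ENNReal.ofReal_natCast, ← ENNReal.ofReal_mul (by positivity)]
      refine ENNReal.ofReal_le_ofReal ?_
      refine (mul_le_mul_of_nonneg_right (hN (n0 + k) (by omega)) (by positivity)).trans ?_
      rw [← Real.exp_add, ← Real.exp_nat_mul]
      refine Real.exp_le_exp.mpr ?_
      push_cast
      have h1 : (0 : ℝ) ≤ n0 * δ := by positivity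
      rw [hδ] at h1 ⊢
      linarith
  have hfin : ∑' k : ℕ, ENNReal.ofReal (Real.exp (-δ) ^ k) ≠ ∞ := by
    rw [← ENNReal.ofReal_tsum_of_nonneg (fun k => by positivity)]
    · exact ENNReal.ofReal_ne_top
    · exact summable_geometric_of_lt_one (by positivity) (by rw [Real.exp_lt_one_iff]; linarith)
  have := dimH_le_of_hausdorffMeasure_ne_top (X := SeqSpace A) (s := recSet X ψ) (d := s.toNNReal)
    (by rw [Real.coe_toNNReal s hs.le]; exact ne_top_of_le_ne_top hfin hmain)
  exact this

theorem bs_not_lexLe {A : Type*} [LinearOrder A] {u v : SeqSpace A} (h : LexLe u v) (n : ℕ)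
    (h1 : ∀ i < n, u i = v i) (h2 : v n < u n) : False := by
  rcases h with h | ⟨k, hk1, hk2⟩
  · rw [h] at h2; exact lt_irrefl _ h2
  · rcases lt_trichotomy k n with hkn | hkn | hkn
    · rw [h1 k hkn] at hk2; exact lt_irrefl _ hk2
    · subst hkn; exact lt_asymm hk2 h2
    · rw [hk1 n hkn] at h2; exact lt_irrefl _ h2

theorem bs_exists_of_not_lexLe {A : Type*} [LinearOrder A] {u v : SeqSpace A} (h : ¬ LexLe u v) :
    ∃ n, (∀ i < n, u i = v i) ∧ v n < u n := by
  have hne : u ≠ v := fun e => h (Or.inl e)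
  refine ⟨lcp u v, ?_, ?_⟩
  · intro i hi
    have := Nat.notMem_of_lt_sInf hi
    simpa using this
  · rcases lt_or_gt_of_ne (lcp_mem hne) with h1 | h1
    · refine absurd (Or.inr ⟨lcp u v, ?_, h1⟩) h
      intro i hi
      have := Nat.notMem_of_lt_sInf hi
      simpa using this
    · exact h1

/-- Words of length `N` (padded by zeros) all of whose suffixes are strictly below `w`. -/
def bsGood {m : ℕ} [NeZero m] (w : SeqSpace (Fin m)) (N : ℕ) : Set (ℕ → Fin m) :=
  {u | (∀ k < N, ∃ n, k + n < N ∧ (∀ i < n, u (k + i) = w i) ∧ u (k + n) < w n) ∧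
    ∀ i, N ≤ i → u i = 0}

theorem bsGood_mono {m : ℕ} [NeZero m] (w : SeqSpace (Fin m)) (hw0 : 0 < w 0) :
    Monotone (bsGood w) := by
  refine monotone_nat_of_le_succ fun N u hu => ⟨fun k hk => ?_, fun i hi => hu.2 i (by omega)⟩
  rcases Nat.lt_succ_iff_lt_or_eq.mp hk with hk | hk
  · obtain ⟨n, h1, h2⟩ := hu.1 k hk
    exact ⟨n, by omega, h2⟩
  · refine ⟨0, by omega, by simp, ?_⟩
    rw [hu.2 _ (by omega)]; exact hw0

theorem bsGood_finite {m : ℕ} [NeZero m] (w : SeqSpace (Fin m)) (N : ℕ) :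
    (bsGood w N).Finite := by
  refine Set.Finite.of_finite_image (f := fun u => fun i : Fin N => u i) (Set.toFinite _) ?_
  intro u hu v hv huv
  funext i
  by_cases hi : i < N
  · exact congrFun huv ⟨i, hi⟩
  · rw [hu.2 i (by omega), hv.2 i (by omega)]

theorem bs_count {m : ℕ} [NeZero m] (w : SeqSpace (Fin m)) (hw0 : 0 < w 0)
    (hself : ∀ j : ℕ, LexLe (shift^[j] w) w) (X : Set (SeqSpace (Fin m)))
    (hX : ∀ x ∈ X, ∀ j : ℕ, 1 ≤ j → LexLe (shift^[j] x) w) (N : ℕ) (hN : 1 ≤ N) :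
    (wordsOfLen (language X) N).ncard ≤ m * (N * (bsGood w N).ncard) := by
  classical
  let G : Fin m × ℕ × (ℕ → Fin m) → List (Fin m) := fun q =>
    q.1 :: List.ofFn (fun i : Fin (N - 1) => if (i : ℕ) < q.2.1 then q.2.2 i else w (i - q.2.1))
  let D : Set (Fin m × ℕ × (ℕ → Fin m)) :=
    (Set.univ : Set (Fin m)) ×ˢ ((Finset.range N : Finset ℕ) : Set ℕ) ×ˢ bsGood w N
  have hD : D.Finite := Set.finite_univ.prod ((Finset.finite_toSet _).prod (bsGood_finite w N))
  have hsub : wordsOfLen (language X) N ⊆ G '' D := by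
    rintro v ⟨⟨x, hx, k, hocc⟩, hlen⟩
    have hz : ∀ j, LexLe (shift^[k + 1 + j] x) w := fun j => hX x hx _ (by omega)
    have hex : ∃ a, a ≤ N - 1 ∧ ∀ i, a + i < N - 1 → x (k + 1 + (a + i)) = w i :=
      ⟨N - 1, le_refl _, fun i hi => by omega⟩
    let a := Nat.find hex
    obtain ⟨ha1, ha2⟩ : a ≤ N - 1 ∧ ∀ i, a + i < N - 1 → x (k + 1 + (a + i)) = w i :=
      Nat.find_spec hex
    have hmin : ∀ j < a, ∃ i, j + i < N - 1 ∧ x (k + 1 + (j + i)) ≠ w i := by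
      intro j hj
      have := Nat.find_min hex hj
      push Not at this
      exact this (by omega)
    obtain ⟨u, hpos, hneg⟩ : ∃ u : ℕ → Fin m, (∀ i < a, u i = x (k + 1 + i)) ∧
        ∀ i, a ≤ i → u i = 0 :=
      ⟨fun i => if i < a then x (k + 1 + i) else 0, fun i hi => if_pos hi,
        fun i hi => if_neg (not_lt.mpr hi)⟩
    have hgood : u ∈ bsGood w a := by
      refine ⟨fun j hj => ?_, fun i hi => hneg i hi⟩
      obtain ⟨i₀, hi₀, hne⟩ := hmin j hj
      have hz' := hz j
      rcases hz' with hz' | ⟨n, hn1, hn2⟩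
      · exfalso
        apply hne
        have := congrFun hz' i₀
        rw [bs_shift_iter] at this
        rw [← this]; congr 1; omega
      · have hn1' : ∀ i < n, x (k + 1 + (j + i)) = w i := by
          intro i hi
          have := hn1 i hi
          rw [bs_shift_iter] at this
          rw [← this]; congr 1; omega
        have hn2' : x (k + 1 + (j + n)) < w n := by
          rw [bs_shift_iter] at hn2
          rwa [show k + 1 + (j + n) = k + 1 + j + n by omega]
        have hni : n ≤ i₀ := by
          by_contra hcon
          exact hne (hn1' i₀ (by omega))
        by_cases hna : j + n < a
        · refine ⟨n, hna, fun i hi => ?_, ?_⟩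
          · rw [hpos _ (by omega)]; exact hn1' i hi
          · rw [hpos _ hna]; exact hn2'
        · exfalso
          obtain ⟨i, hi⟩ := Nat.exists_eq_add_of_le (not_lt.mp hna)
          refine bs_not_lexLe (hself (a - j)) i ?_ ?_
          · intro i' hi'
            rw [bs_shift_iter, ← hn1' (a - j + i') (by omega), ← ha2 i' (by omega)]
            congr 1; omega
          · rw [bs_shift_iter, ← ha2 i (by omega), ← hi, show a - j + i = n by omega]
            exact hn2'
    refine ⟨(x k, a, u), ⟨mem_univ _, ?_, ?_⟩, ?_⟩
    · simp only [Finset.coe_range, Set.mem_Iio]; omega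
    · exact bsGood_mono w hw0 (by omega : a ≤ N) hgood
    · refine List.ext_getElem ?_ ?_
      · simp only [G, List.length_cons, List.length_ofFn]; omega
      · intro i h1 h2
        have := hocc i h2
        rw [← this]
        rcases i with _ | i
        · simp [G]
        · have h3 : i < N - 1 := by omega
          simp only [G, List.getElem_cons_succ, List.getElem_ofFn]
          by_cases hia : i < a
          · rw [if_pos hia, hpos _ hia]; congr 1; omega
          · rw [if_neg hia, ← ha2 (i - a) (by omega)]; congr 1; omega
  calc (wordsOfLen (language X) N).ncard ≤ (G '' D).ncard := Set.ncard_le_ncard hsub (hD.image _)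
    _ ≤ D.ncard := Set.ncard_image_le hD
    _ = m * (N * (bsGood w N).ncard) := by
      rw [Set.ncard_prod, Set.ncard_prod, Set.ncard_univ, Set.ncard_coe_finset]
      simp

/-- View a function as a point of the sequence space. -/
def bsMk {A : Type*} (f : ℕ → A) : SeqSpace A := f

theorem bsMk_apply {A : Type*} (f : ℕ → A) (n : ℕ) : bsMk f n = f n := rfl

theorem bs_concat {m : ℕ} [NeZero m] (w : SeqSpace (Fin m)) (N : ℕ) (hN : 1 ≤ N)
    (c : ℕ → ℕ → Fin m) (hc : ∀ q, c q ∈ bsGood w N) (j : ℕ) :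
    LexLe (shift^[j] (bsMk fun n => c (n / N) (n % N))) w := by
  obtain ⟨n, h1, h2, h3⟩ := (hc (j / N)).1 (j % N) (Nat.mod_lt _ hN)
  have key : ∀ i, j % N + i < N → (j + i) / N = j / N ∧ (j + i) % N = j % N + i := by
    intro i hi
    have e : j + i = (j % N + i) + N * (j / N) := by
      have := Nat.mod_add_div j N; omega
    constructor
    · rw [e, Nat.add_mul_div_left _ _ hN, Nat.div_eq_of_lt hi, zero_add]
    · rw [e, Nat.add_mul_mod_self_left, Nat.mod_eq_of_lt hi]
  refine Or.inr ⟨n, fun i hi => ?_, ?_⟩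
  · rw [bs_shift_iter, bsMk_apply]
    obtain ⟨k1, k2⟩ := key i (by omega)
    simp only [k1, k2]
    exact h2 i hi
  · rw [bs_shift_iter, bsMk_apply]
    obtain ⟨k1, k2⟩ := key n h1
    simp only [k1, k2]
    exact h3

/-- The value of a digit sequence in base `β`. -/
def bsVal (β : ℝ) {m : ℕ} (v : SeqSpace (Fin m)) : ℝ :=
  ∑' j : ℕ, ((v j : ℕ) : ℝ) / β ^ (j + 1)

theorem bsVal_summable {β : ℝ} (hβ : 1 < β) {m : ℕ} (v : SeqSpace (Fin m)) :
    Summable (fun j : ℕ => ((v j : ℕ) : ℝ) / β ^ (j + 1)) := by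
  have hg : Summable (fun j : ℕ => (m : ℝ) * (β⁻¹) ^ (j + 1)) := by
    refine Summable.mul_left _ ?_
    exact (summable_nat_add_iff 1).mpr
      (summable_geometric_of_lt_one (by positivity) (inv_lt_one_of_one_lt₀ hβ))
  refine Summable.of_nonneg_of_le (fun j => by positivity) (fun j => ?_) hg
  rw [div_eq_mul_inv, inv_pow]
  have : ((v j : ℕ) : ℝ) ≤ m := by exact_mod_cast (v j).2.le
  gcongr

theorem bsVal_nonneg {β : ℝ} (hβ : 1 < β) {m : ℕ} (v : SeqSpace (Fin m)) : 0 ≤ bsVal β v :=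
  tsum_nonneg fun j => by positivity

theorem bsVal_step {β : ℝ} (hβ : 1 < β) {m : ℕ} (v : SeqSpace (Fin m)) :
    β * bsVal β v = ((v 0 : ℕ) : ℝ) + bsVal β (shift v) := by
  have hβ0 : β ≠ 0 := by linarith
  unfold bsVal
  rw [(bsVal_summable hβ v).tsum_eq_zero_add, mul_add, ← tsum_mul_left]
  congr 1
  · rw [zero_add, pow_one]; field_simp
  · refine tsum_congr fun j => ?_
    show _ = ((v (j + 1) : ℕ) : ℝ) / _
    rw [pow_succ β (j + 1)]
    field_simp

theorem bsVal_agree {β : ℝ} (hβ : 1 < β) {m : ℕ} (n : ℕ) (u v : SeqSpace (Fin m))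
    (h : ∀ i < n, u i = v i) :
    β ^ n * (bsVal β u - bsVal β v) = bsVal β (shift^[n] u) - bsVal β (shift^[n] v) := by
  induction n generalizing u v with
  | zero => simp
  | succ n ih =>
    rw [Function.iterate_succ_apply, Function.iterate_succ_apply,
      ← ih (shift u) (shift v) (fun i hi => h (i + 1) (by omega))]
    have h1 := bsVal_step hβ u
    have h2 := bsVal_step hβ v
    rw [h 0 (by omega)] at h1
    rw [pow_succ, mul_assoc, mul_sub, h1, h2]
    ring

theorem bsVal_le {β : ℝ} (hβ : 1 < β) {m : ℕ} (v : SeqSpace (Fin m)) :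
    bsVal β v ≤ ((m : ℝ) - 1) / (β - 1) := by
  have hg : HasSum (fun j : ℕ => ((m : ℝ) - 1) * (β⁻¹ * (β⁻¹) ^ j))
      (((m : ℝ) - 1) * (β⁻¹ * (1 - β⁻¹)⁻¹)) :=
    ((hasSum_geometric_of_lt_one (by positivity) (inv_lt_one_of_one_lt₀ hβ)).mul_left _).mul_left _
  have hβ0 : β ≠ 0 := by linarith
  have hβ1 : β - 1 ≠ 0 := by linarith
  have e : ((m : ℝ) - 1) / (β - 1) = ((m : ℝ) - 1) * (β⁻¹ * (1 - β⁻¹)⁻¹) := by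
    rw [← mul_inv, mul_sub, mul_inv_cancel₀ hβ0, mul_one]; rfl
  rw [e]
  refine hasSum_le (fun j => ?_) (bsVal_summable hβ v).hasSum hg
  rw [div_eq_mul_inv, ← pow_succ', inv_pow]
  have : ((v j : ℕ) : ℝ) ≤ (m : ℝ) - 1 := by
    have h2 : ((v j : ℕ) : ℝ) + 1 ≤ m := by exact_mod_cast (v j).2
    linarith
  gcongr

theorem bsVal_exists {β : ℝ} (hβ : 1 < β) {m : ℕ} (hm : β ≤ m) (y : ℝ) (hy0 : 0 ≤ y)
    (hy1 : y ≤ ((m : ℝ) - 1) / (β - 1)) : ∃ v : SeqSpace (Fin m), bsVal β v = y := by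
  have hβ1 : 0 < β - 1 := by linarith
  have hm1 : 1 < m := by
    have : (1 : ℝ) < m := by linarith
    exact_mod_cast this
  set C : ℝ := ((m : ℝ) - 1) / (β - 1) with hC
  have hCe : β * C - ((m : ℝ) - 1) = C := by rw [hC]; field_simp; ring
  have hC1 : 1 ≤ C := by rw [hC, le_div_iff₀ hβ1]; linarith
  let d : ℝ → Fin m := fun y => ⟨min (m - 1) ⌊β * y⌋₊, by omega⟩
  let Y : ℕ → ℝ := fun n => (fun y => β * y - ((d y : ℕ) : ℝ))^[n] y
  have hYs : ∀ n, Y (n + 1) = β * Y n - ((d (Y n) : ℕ) : ℝ) := fun n =>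
    Function.iterate_succ_apply' _ _ _
  have hY : ∀ n, 0 ≤ Y n ∧ Y n ≤ C := by
    intro n
    induction n with
    | zero => exact ⟨hy0, hy1⟩
    | succ n ih =>
      have hby : 0 ≤ β * Y n := mul_nonneg (by linarith) ih.1
      have hfl := Nat.floor_le hby
      rw [hYs]
      constructor
      · have : ((d (Y n) : ℕ) : ℝ) ≤ (⌊β * Y n⌋₊ : ℝ) := by
          exact_mod_cast min_le_right _ _
        linarith
      · by_cases hc : m - 1 ≤ ⌊β * Y n⌋₊
        · have e : (d (Y n) : ℕ) = m - 1 := min_eq_left hc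
          rw [e, Nat.cast_sub (by omega), Nat.cast_one]
          have := mul_le_mul_of_nonneg_left ih.2 (by linarith : (0 : ℝ) ≤ β)
          linarith
        · have e : (d (Y n) : ℕ) = ⌊β * Y n⌋₊ := min_eq_right (by omega)
          rw [e]
          have := Nat.lt_floor_add_one (β * Y n)
          linarith
  refine ⟨fun n => d (Y n), ?_⟩
  have hpart : ∀ n, ∑ j ∈ Finset.range n, ((d (Y j) : ℕ) : ℝ) / β ^ (j + 1)
      = y - Y n / β ^ n := by
    intro n
    induction n with
    | zero => simp [Y]
    | succ n ih =>
      rw [Finset.sum_range_succ, ih, hYs]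
      have hβ0 : β ≠ 0 := by linarith
      rw [pow_succ]
      field_simp
      ring
  refine HasSum.tsum_eq ?_
  rw [hasSum_iff_tendsto_nat_of_nonneg (fun j => by positivity)]
  simp_rw [hpart, div_eq_mul_inv, ← inv_pow]
  have h0 : Tendsto (fun n => Y n * (β⁻¹) ^ n) atTop (nhds 0) := by
    have hz : Tendsto (fun n : ℕ => C * (β⁻¹) ^ n) atTop (nhds 0) := by
      have := (tendsto_pow_atTop_nhds_zero_of_lt_one (r := β⁻¹) (by positivity)
        (inv_lt_one_of_one_lt₀ hβ)).const_mul C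
      simpa using this
    refine squeeze_zero (fun n => mul_nonneg (hY n).1 (by positivity)) (fun n => ?_) hz
    exact mul_le_mul_of_nonneg_right (hY n).2 (by positivity)
  simpa using h0.const_sub y

theorem bs_tail_le {β : ℝ} (hβ : 1 < β) {m : ℕ} (hm : β ≤ m) (w : SeqSpace (Fin m))
    (hw1 : bsVal β w = 1) (hwmax : ∀ v : SeqSpace (Fin m), bsVal β v = 1 → LexLe v w) (j : ℕ) :
    bsVal β (shift^[j] w) ≤ 1 := by
  induction j with
  | zero => exact hw1.le
  | succ j ih =>
    by_contra hcon
    push Not at hcon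
    have hs := bsVal_step hβ (shift^[j] w)
    have e0 : (shift^[j] w) 0 = w j := bs_shift_iter w j 0
    rw [e0, ← Function.iterate_succ_apply' shift j w] at hs
    have hlt : (w j : ℕ) + 1 < m := by
      have : ((w j : ℕ) : ℝ) + 1 < m := by nlinarith
      exact_mod_cast this
    obtain ⟨v', hv'⟩ := bsVal_exists hβ hm (bsVal β (shift^[j + 1] w) - 1) (by linarith)
      (by linarith [bsVal_le hβ (shift^[j + 1] w)])
    let v : SeqSpace (Fin m) := fun i =>
      if i < j then w i else if i = j then ⟨(w j : ℕ) + 1, hlt⟩ else v' (i - j - 1)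
    have hvj : (v j : ℕ) = (w j : ℕ) + 1 := by simp [v]
    have hvlt : ∀ i < j, v i = w i := fun i hi => by simp [v, hi]
    have hp := bsVal_agree hβ j v w hvlt
    have hs2 := bsVal_step hβ (shift^[j] v)
    have e1 : (shift^[j] v) 0 = v j := bs_shift_iter v j 0
    have e2 : shift (shift^[j] v) = v' := by
      rw [← Function.iterate_succ_apply' shift j v]
      funext i
      rw [bs_shift_iter]
      simp only [v]
      rw [if_neg (by omega), if_neg (by omega)]
      congr 1; omega
    rw [e1, e2, hvj, hv'] at hs2
    push_cast at hs2
    have h0 : bsVal β (shift^[j] v) - bsVal β (shift^[j] w) = 0 := by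
      have : β * (bsVal β (shift^[j] v) - bsVal β (shift^[j] w)) = 0 := by
        rw [mul_sub, hs, hs2]; ring
      rcases mul_eq_zero.mp this with h | h
      · linarith
      · exact h
    rw [h0] at hp
    have hv1 : bsVal β v = 1 := by
      rcases mul_eq_zero.mp hp with h | h
      · have : 0 < β ^ j := by positivity
        linarith
      · linarith
    refine bs_not_lexLe (hwmax v hv1) j hvlt ?_
    rw [Fin.lt_def, hvj]; omega

theorem bs_self {β : ℝ} (hβ : 1 < β) {m : ℕ} (hm : β ≤ m) (w : SeqSpace (Fin m))
    (hw1 : bsVal β w = 1) (hwmax : ∀ v : SeqSpace (Fin m), bsVal β v = 1 → LexLe v w) (j : ℕ) :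
    LexLe (shift^[j] w) w := by
  by_contra hcon
  obtain ⟨n, h1, h2⟩ := bs_exists_of_not_lexLe hcon
  apply hcon
  apply hwmax
  refine le_antisymm (bs_tail_le hβ hm w hw1 hwmax j) ?_
  have hp := bsVal_agree hβ n _ _ h1
  have hs1 := bsVal_step hβ (shift^[n] (shift^[j] w))
  have hs2 := bsVal_step hβ (shift^[n] w)
  rw [← Function.iterate_succ_apply' shift n w] at hs2
  have hle := bs_tail_le hβ hm w hw1 hwmax (n + 1)
  have hnn := bsVal_nonneg hβ (shift (shift^[n] (shift^[j] w)))
  rw [show (shift^[n] (shift^[j] w)) 0 = (shift^[j] w) n from bs_shift_iter _ n 0] at hs1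
  rw [show (shift^[n] w) 0 = w n from bs_shift_iter _ n 0] at hs2
  have hd : ((w n : ℕ) : ℝ) + 1 ≤ (((shift^[j] w) n : ℕ) : ℝ) := by exact_mod_cast h2
  have h3 : 0 ≤ β * (bsVal β (shift^[n] (shift^[j] w)) - bsVal β (shift^[n] w)) := by
    rw [mul_sub]; linarith
  have h4 : 0 ≤ β ^ n * (bsVal β (shift^[j] w) - bsVal β w) := by
    rw [hp]; exact nonneg_of_mul_nonneg_right h3 (by linarith)
  have h5 := nonneg_of_mul_nonneg_right h4 (by positivity)
  linarith

theorem bs_head_pos {β : ℝ} (hβ : 1 < β) {m : ℕ} [NeZero m] (hm : β ≤ m) (w : SeqSpace (Fin m))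
    (hw1 : bsVal β w = 1) (hwmax : ∀ v : SeqSpace (Fin m), bsVal β v = 1 → LexLe v w) :
    0 < w 0 := by
  rw [Fin.pos_iff_ne_zero]
  intro h0
  have hs := bsVal_step hβ w
  have := bs_tail_le hβ hm w hw1 hwmax 1
  rw [h0, hw1] at hs
  simp at hs this
  linarith

theorem bs_rec_exists {T : Type*} (S : ℕ → Prop) (f : ℕ → ℕ) (hf : ∀ i, ¬ S i → f i < i)
    (g : ℕ → T) : ∃ z : ℕ → T, (∀ i, S i → z i = g i) ∧ (∀ i, ¬ S i → z i = z (f i)) := by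
  classical
  let F : ∀ i : ℕ, (∀ j, j < i → T) → T := fun i z => if h : S i then g i else z (f i) (hf i h)
  have hfix : ∀ i, (wellFounded_lt (α := ℕ)).fix F i =
      F i (fun j _ => (wellFounded_lt (α := ℕ)).fix F j) := fun i => WellFounded.fix_eq _ _ _
  refine ⟨(wellFounded_lt (α := ℕ)).fix F, fun i hi => ?_, fun i hi => ?_⟩
  · rw [hfix]; exact dif_pos hi
  · rw [hfix]; exact dif_neg hi

theorem bs_count_exists (S : ℕ → Prop) [DecidablePred S] (Q j : ℕ) (hj : j < Nat.count S Q) :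
    ∃ t < Q, S t ∧ Nat.count S t = j := by
  induction Q with
  | zero => simp at hj
  | succ Q ih =>
    by_cases h : j < Nat.count S Q
    · obtain ⟨t, h1, h2⟩ := ih h
      exact ⟨t, by omega, h2⟩
    · rw [Nat.count_succ] at hj
      by_cases hS : S Q
      · rw [if_pos hS] at hj
        exact ⟨Q, by omega, hS, by omega⟩
      · rw [if_neg hS] at hj
        omega

theorem bs_dim_of_coding {A : Type*} {M : ℕ} (hM : 1 < M) (Φ : (ℕ → Fin M) → SeqSpace A)
    (hinj : Function.Injective Φ) (C r : ℝ≥0) (hr : 0 < r)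
    (hagree : ∀ y y' : ℕ → Fin M, ∀ n : ℕ, (∀ i < n, Φ y i = Φ y' i) →
      ∃ k : ℕ, (∀ j < k, y j = y' j) ∧ ((M : ℝ) ^ k)⁻¹ ≤ C * Real.exp (-(n * r))) :
    (r : ℝ≥0∞) ≤ dimH (Set.range Φ) := by
  have : Nonempty (ℕ → Fin M) := ⟨fun _ => ⟨0, by omega⟩⟩
  let f : SeqSpace A → ℝ := fun x => Real.ofDigits (Function.invFun Φ x)
  have hf : ∀ y, f (Φ y) = Real.ofDigits y := fun y => by
    simp only [f]
    rw [Function.leftInverse_invFun hinj y]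
  have hH : HolderOnWith C r f (Set.range Φ) := by
    rintro _ ⟨y, rfl⟩ _ ⟨y', rfl⟩
    rw [hf, hf]
    by_cases hne : Φ y = Φ y'
    · rw [hinj hne]; simp
    · obtain ⟨k, hk1, hk2⟩ := hagree y y' (lcp (Φ y) (Φ y')) (fun i hi => by
        have := Nat.notMem_of_lt_sInf hi
        simpa using this)
      have hd : dist (Φ y) (Φ y') = Real.exp (-(lcp (Φ y) (Φ y') : ℝ)) := by
        show sdist _ _ = _
        rw [sdist, if_neg hne]
      rw [edist_dist, edist_dist, hd, ENNReal.ofReal_rpow_of_nonneg (by positivity) (by positivity),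
        ← Real.exp_mul, ← ENNReal.ofReal_coe_nnreal, ← ENNReal.ofReal_mul (by positivity)]
      refine ENNReal.ofReal_le_ofReal ?_
      rw [Real.dist_eq, neg_mul]
      exact (Real.abs_ofDigits_sub_ofDigits_le hk1).trans hk2
  have himg : Set.Icc (0 : ℝ) 1 ⊆ f '' Set.range Φ := by
    intro t ht
    obtain ⟨y, -, hy⟩ := Real.ofDigits_SurjOn hM ht
    exact ⟨Φ y, ⟨y, rfl⟩, by rw [hf, hy]⟩
  have h1 : dimH (Set.Icc (0 : ℝ) 1) = 1 := by
    rw [Real.dimH_of_nonempty_interior (by simp)]; simp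
  have h2 : (1 : ℝ≥0∞) ≤ dimH (Set.range Φ) / r := by
    rw [← h1]
    exact (dimH_mono himg).trans (hH.dimH_image_le hr)
  rwa [ENNReal.le_div_iff_mul_le (Or.inl (by exact_mod_cast hr.ne')) (Or.inl ENNReal.coe_ne_top),
    one_mul] at h2

theorem bs_lower {A : Type*} (X : Set (SeqSpace A)) (ψ : ℕ → ℝ) (N M : ℕ) (hN : 1 ≤ N)
    (hM : 1 < M) (c : Fin M → ℕ → A) (hc : ∀ a b, (∀ i < N, c a i = c b i) → a = b)
    (hX : ∀ z : ℕ → Fin M, bsMk (fun n => c (z (n / N)) (n % N)) ∈ X)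
    (l : ℝ) (hl : 0 < l)
    (hpq : ∀ E : ℕ, ∃ p q : ℕ, 0 < p ∧ (E : ℝ) + l * (p + q) ≤ p ∧
      Real.exp (-((N : ℝ) * q)) < ψ (N * p)) :
    ENNReal.ofReal (l * Real.log M / N) ≤ dimH (recSet X ψ) := by
  classical
  choose P Q hP0 hPQ hPψ using hpq
  let e : ℕ → ℕ := fun k => (fun E => P E + Q E)^[k] 0
  have he : ∀ k, e (k + 1) = P (e k) + Q (e k) := fun k => Function.iterate_succ_apply' _ _ _
  have hEP : ∀ E, E < P E := by
    intro E
    have h1 := hPQ E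
    have h2 : (0 : ℝ) < P E := by exact_mod_cast hP0 E
    have h3 : (0 : ℝ) ≤ Q E := by positivity
    have h4 : (E : ℝ) < P E := by
      have : 0 < l * (P E + Q E) := by positivity
      linarith
    exact_mod_cast h4
  have hl1 : l ≤ 1 := by
    have h1 := hPQ 0
    have h2 : (0 : ℝ) < P 0 := by exact_mod_cast hP0 0
    have h3 : (0 : ℝ) ≤ Q 0 := by positivity
    by_contra hcon
    push Not at hcon
    push_cast at h1
    nlinarith
  have hemono : StrictMono e := strictMono_nat_of_lt_succ fun k => by
    rw [he]; have := hEP (e k); omega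
  let S : ℕ → Prop := fun i => ∀ k, ¬ (P (e k) ≤ i ∧ i < e (k + 1))
  -- the intervals are disjoint
  have hlt : ∀ k k', k < k' → e (k + 1) < P (e k') := by
    intro k k' hk
    exact (hemono.monotone (by omega : k + 1 ≤ k')).trans_lt (hEP _)
  have huniq : ∀ i k k', (P (e k) ≤ i ∧ i < e (k + 1)) → (P (e k') ≤ i ∧ i < e (k' + 1)) →
      k = k' := by
    intro i k k' h1 h2
    rcases lt_trichotomy k k' with h | h | h
    · have := hlt k k' h; omega
    · exact h
    · have := hlt k' k h; omega
  have hfree : ∀ k i, e k ≤ i → i < P (e k) → S i := by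
    intro k i h1 h2 k' h3
    rcases lt_or_ge k' k with h | h
    · have := hemono.monotone (by omega : k' + 1 ≤ k); omega
    · rcases h.eq_or_lt with h | h
      · subst h; omega
      · have := hlt k k' h
        have := he k
        omega
  have hcnt1 : ∀ k d, e k + d ≤ P (e k) → d ≤ Nat.count S (e k + d) := by
    intro k d
    induction d with
    | zero => intro _; exact Nat.zero_le _
    | succ d ih =>
      intro h
      rw [← add_assoc, Nat.count_succ, if_pos (hfree k _ (by omega) (by omega))]
      have := ih (by omega)
      omega
  have hcnt : ∀ n : ℕ, l * n ≤ Nat.count S n := by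
    intro n
    induction n with
    | zero => simp
    | succ n ih =>
      by_cases hS : S n
      · rw [Nat.count_succ, if_pos hS]
        push_cast
        linarith
      · simp only [S] at hS
        push Not at hS
        obtain ⟨k, hk1, hk2⟩ := hS
        have h1 := hcnt1 k (P (e k) - e k) (by have := hEP (e k); omega)
        rw [Nat.add_sub_cancel' (hEP (e k)).le] at h1
        have h2 := Nat.count_monotone S (by omega : P (e k) ≤ n + 1)
        have h3 := hPQ (e k)
        have h4 : (P (e k) : ℝ) ≤ Nat.count S (n + 1) + e k := by
          have : P (e k) ≤ Nat.count S (n + 1) + e k := by omega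
          exact_mod_cast this
        have h5 : ((n + 1 : ℕ) : ℝ) ≤ P (e k) + Q (e k) := by
          have : n + 1 ≤ P (e k) + Q (e k) := by rw [← he]; omega
          exact_mod_cast this
        have h6 := mul_le_mul_of_nonneg_left h5 hl.le
        linarith
  -- the back step
  have hback : ∃ f : ℕ → ℕ, (∀ i, ¬ S i → f i < i) ∧
      ∀ k i, P (e k) ≤ i → i < e (k + 1) → f i = i - P (e k) := by
    refine ⟨fun i => if h : ∃ k, P (e k) ≤ i ∧ i < e (k + 1) then i - P (e h.choose) else 0, ?_, ?_⟩
    · intro i hi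
      have h : ∃ k, P (e k) ≤ i ∧ i < e (k + 1) := by
        simp only [S] at hi; push Not at hi; exact hi
      simp only [dif_pos h]
      have := h.choose_spec
      have := hP0 (e h.choose)
      omega
    · intro k i h1 h2
      have h : ∃ k, P (e k) ≤ i ∧ i < e (k + 1) := ⟨k, h1, h2⟩
      simp only [dif_pos h]
      rw [huniq i _ _ h.choose_spec ⟨h1, h2⟩]
  obtain ⟨f, hf1, hf2⟩ := hback
  have hz : ∀ y : ℕ → Fin M, ∃ z : ℕ → Fin M, (∀ i, S i → z i = y (Nat.count S i)) ∧
      (∀ i, ¬ S i → z i = z (f i)) := fun y => bs_rec_exists S f hf1 (fun i => y (Nat.count S i))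
  choose z hz1 hz2 using hz
  have hz3 : ∀ y k t, t < Q (e k) → z y (P (e k) + t) = z y t := by
    intro y k t ht
    have h2 : P (e k) + t < e (k + 1) := by rw [he]; omega
    rw [hz2 y (P (e k) + t) (fun hS => hS k ⟨by omega, h2⟩), hf2 k _ (by omega) h2,
      Nat.add_sub_cancel_left]
  let Φ : (ℕ → Fin M) → SeqSpace A := fun y => bsMk (fun n => c (z y (n / N)) (n % N))
  have hΦ : ∀ y n, Φ y n = c (z y (n / N)) (n % N) := fun y n => rfl
  have hblock : ∀ y y' n, (∀ i < n, Φ y i = Φ y' i) → ∀ j < Nat.count S (n / N), y j = y' j := by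
    intro y y' n hag j hj
    obtain ⟨t, ht1, ht2, ht3⟩ := bs_count_exists S _ _ hj
    have hzz : z y t = z y' t := by
      apply hc
      intro i hi
      have hlt' : N * t + i < n := by
        have h1 : N * (t + 1) ≤ N * (n / N) := Nat.mul_le_mul_left _ ht1
        have h2 := Nat.mul_div_le n N
        rw [mul_add] at h1
        omega
      have := hag _ hlt'
      rw [hΦ, hΦ, Nat.mul_add_div hN, Nat.div_eq_of_lt hi, Nat.mul_add_mod, Nat.mod_eq_of_lt hi,
        add_zero] at this
      exact this
    rw [hz1 y t ht2, hz1 y' t ht2, ht3] at hzz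
    exact hzz
  have hinj : Function.Injective Φ := by
    intro y y' hyy
    funext j
    obtain ⟨q, hq⟩ := exists_nat_gt (((j : ℝ) + 1) / l)
    rw [div_lt_iff₀ hl] at hq
    refine hblock y y' (N * q) (fun i _ => by rw [hyy]) j ?_
    rw [Nat.mul_div_cancel_left _ hN]
    have := hcnt q
    have h2 : (j : ℝ) < Nat.count S q := by linarith
    exact_mod_cast h2
  have hrange : Set.range Φ ⊆ recSet X ψ := by
    rintro _ ⟨y, rfl⟩
    refine ⟨hX _, ?_⟩
    rw [frequently_atTop]
    intro n0
    refine ⟨N * P (e n0), ?_, ?_⟩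
    · have h1 := hemono.id_le n0
      have h2 := hEP (e n0)
      simp only [id] at h1
      nlinarith
    · refine lt_of_le_of_lt (bs_dist_le_of_agree ?_) (hPψ (e n0))
      intro i hi
      have hi' : i < N * Q (e n0) := by exact_mod_cast hi
      rw [bs_shift_iter, hΦ, hΦ, Nat.mul_add_div hN, Nat.mul_add_mod,
        hz3 y n0 _ (Nat.div_lt_of_lt_mul hi')]
  have hMpos : (0 : ℝ) < M := by positivity
  have hlogM : 0 < Real.log M := Real.log_pos (by exact_mod_cast hM)
  have hNpos : (0 : ℝ) < N := by exact_mod_cast hN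
  have hr0 : 0 < l * Real.log M / N := by positivity
  refine le_trans ?_ (dimH_mono hrange)
  refine bs_dim_of_coding hM Φ hinj (M : ℝ≥0) (l * Real.log M / N).toNNReal
    (Real.toNNReal_pos.mpr hr0) ?_
  intro y y' n hag
  refine ⟨Nat.count S (n / N), hblock y y' n hag, ?_⟩
  rw [Real.coe_toNNReal _ hr0.le]
  have e1 : ((M : ℝ) ^ Nat.count S (n / N))⁻¹
      = Real.exp (-(Nat.count S (n / N) * Real.log M)) := by
    rw [Real.exp_neg, Real.exp_nat_mul, Real.exp_log hMpos]
  have e2 : (((M : ℝ≥0) : ℝ≥0) : ℝ) = Real.exp (Real.log M) := by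
    rw [Real.exp_log hMpos]; simp
  rw [e1, e2, ← Real.exp_add, Real.exp_le_exp]
  have h1 := hcnt (n / N)
  have h2 : (n : ℝ) ≤ N * (((n / N : ℕ) : ℝ) + 1) := by
    have : n < N * (n / N + 1) := by
      have := Nat.mod_add_div n N
      have := Nat.mod_lt n hN
      rw [mul_add]; omega
    exact_mod_cast this.le
  have h3 : (n : ℝ) * (l * Real.log M / N) ≤ (l * ((n / N : ℕ) : ℝ) + l) * Real.log M := by
    rw [← mul_div_assoc, div_le_iff₀ hNpos]
    have := mul_le_mul_of_nonneg_right h2 (by positivity : (0 : ℝ) ≤ l * Real.log M)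
    linarith
  have h4 : (l * ((n / N : ℕ) : ℝ) + l) * Real.log M
      ≤ ((Nat.count S (n / N) : ℝ) + 1) * Real.log M :=
    mul_le_mul_of_nonneg_right (by linarith) hlogM.le
  linarith

theorem bs_gap (ψ : ℕ → ℝ) (hψpos : ∀ n, 0 < ψ n) (hψanti : Antitone ψ) (B l : ℝ) (hB : 0 < B)
    (hl : 0 < l) (hlB : l * (1 + B) < 1) (hfr : ∃ᶠ n : ℕ in atTop, -Real.log (ψ n) < B * n)
    (N : ℕ) (hN : 1 ≤ N) (E : ℕ) :
    ∃ p q : ℕ, 0 < p ∧ (E : ℝ) + l * (p + q) ≤ p ∧ Real.exp (-((N : ℝ) * q)) < ψ (N * p) := by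
  have hNpos : (0 : ℝ) < N := by exact_mod_cast hN
  have hl1 : l < 1 := by nlinarith
  obtain ⟨n0, hn0⟩ := exists_nat_ge ((N : ℝ) * (E + 2) / (1 - l * (1 + B)))
  obtain ⟨n, hn, hψn⟩ := frequently_atTop.mp hfr n0
  have hn' : (N : ℝ) * (E + 2) ≤ n * (1 - l * (1 + B)) := by
    rw [← div_le_iff₀ (by linarith)]
    have : (n0 : ℝ) ≤ n := by exact_mod_cast hn
    linarith
  have hx : (E : ℝ) + 2 ≤ (n : ℝ) / N * (1 - l * (1 + B)) := by
    rw [div_mul_eq_mul_div, le_div_iff₀ hNpos]; linarith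
  have hp1 : ((n / N : ℕ) : ℝ) ≤ (n : ℝ) / N := Nat.cast_div_le
  have hp2 : (n : ℝ) / N - 1 ≤ ((n / N : ℕ) : ℝ) := by
    rw [sub_le_iff_le_add, div_le_iff₀ hNpos]
    have : n ≤ (n / N + 1) * N := by
      have := Nat.mod_add_div n N
      have := Nat.mod_lt n hN
      rw [add_mul, mul_comm]; omega
    exact_mod_cast this
  have hq0 : 0 ≤ B * n / N := by positivity
  have hq1 : ((⌊B * n / N⌋₊ + 1 : ℕ) : ℝ) ≤ B * ((n : ℝ) / N) + 1 := by
    push_cast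
    have := Nat.floor_le hq0
    rw [mul_div_assoc] at this ⊢
    linarith
  have hq2 : B * n < N * ((⌊B * n / N⌋₊ + 1 : ℕ) : ℝ) := by
    push_cast
    have := Nat.lt_floor_add_one (B * n / N)
    rw [div_lt_iff₀ hNpos] at this
    linarith
  have hEnn : (0 : ℝ) ≤ E := by positivity
  have hxx : (0 : ℝ) ≤ (n : ℝ) / N := by positivity
  have hmain : (E : ℝ) + l * (((n / N : ℕ) : ℝ) + ((⌊B * n / N⌋₊ + 1 : ℕ) : ℝ))
      ≤ ((n / N : ℕ) : ℝ) := by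
    have h1 : l * (((n / N : ℕ) : ℝ) + ((⌊B * n / N⌋₊ + 1 : ℕ) : ℝ))
        ≤ l * ((n : ℝ) / N + (B * ((n : ℝ) / N) + 1)) :=
      mul_le_mul_of_nonneg_left (by linarith) hl.le
    nlinarith
  refine ⟨n / N, ⌊B * n / N⌋₊ + 1, ?_, hmain, ?_⟩
  · have h5 : (0 : ℝ) < ((n / N : ℕ) : ℝ) := by
      have h6 : (n : ℝ) / N * (1 - l * (1 + B)) ≤ (n : ℝ) / N := by
        have : 0 ≤ (n : ℝ) / N * (l * (1 + B)) := by positivity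
        linarith
      linarith
    exact_mod_cast h5
  · have h7 : Real.exp (-((N : ℝ) * ((⌊B * n / N⌋₊ + 1 : ℕ) : ℝ))) < ψ n := by
      rw [← Real.lt_log_iff_exp_lt (hψpos n)]
      linarith
    exact h7.trans_le (hψanti (Nat.mul_div_le n N))

theorem bs_upper_final {A : Type*} [Finite A] (X : Set (SeqSpace A)) (h : ℝ) (hh : 0 ≤ h)
    (hent : Tendsto (fun n => Real.log ((wordsOfLen (language X) n).ncard) / n)
      atTop (nhds h)) (ψ : ℕ → ℝ) (hψpos : ∀ n, 0 < ψ n) (b : ℝ≥0∞)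
    (hb : atTop.liminf (fun n : ℕ => ENNReal.ofReal (-Real.log (ψ n) / n)) = b) :
    dimH (recSet X ψ) ≤ ENNReal.ofReal h / (1 + b) := by
  by_contra hcon
  push Not at hcon
  obtain ⟨s, hs1, hs2⟩ := ENNReal.lt_iff_exists_nnreal_btwn.mp hcon
  have hs0 : (0 : ℝ) < s := by
    have : (0 : ℝ≥0∞) < s := lt_of_le_of_lt zero_le hs1
    exact_mod_cast this
  have hlt : ∀ B : ℝ, 0 ≤ B → ENNReal.ofReal B < b → ∀ᶠ n : ℕ in atTop,
      B = 0 ∨ ψ n ≤ Real.exp (-(B * n)) := by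
    intro B hB hBb
    rw [← hb] at hBb
    filter_upwards [eventually_lt_of_lt_liminf hBb, eventually_gt_atTop 0] with n hn hn0
    right
    have hn0' : (0 : ℝ) < n := by exact_mod_cast hn0
    have h1 : B < -Real.log (ψ n) / n := by
      by_contra h2
      exact absurd hn (not_lt.mpr (ENNReal.ofReal_le_ofReal (not_lt.mp h2)))
    rw [lt_div_iff₀ hn0'] at h1
    rw [← Real.log_le_iff_le_exp (hψpos n)]
    linarith
  have hB : ∃ B : ℝ, 0 ≤ B ∧ h < s * (1 + B) ∧ ∀ᶠ n : ℕ in atTop,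
      B = 0 ∨ ψ n ≤ Real.exp (-(B * n)) := by
    by_cases hbt : b = ∞
    · refine ⟨h / s, by positivity, ?_, hlt _ (by positivity) (by rw [hbt]; exact ENNReal.ofReal_lt_top)⟩
      rw [mul_add, mul_div_cancel₀ _ hs0.ne']; linarith
    · rw [ENNReal.div_lt_iff (Or.inl (by simp)) (Or.inl (by simp [hbt]))] at hs1
      lift b to ℝ≥0 using hbt
      have hs1' : h < s * (1 + b) := by
        have e : (s : ℝ≥0∞) * (1 + b) = ENNReal.ofReal (s * (1 + b)) := by
          rw [ENNReal.ofReal_mul (by positivity), ENNReal.ofReal_add (by positivity) (by positivity)]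
          simp
        rw [e, ENNReal.ofReal_lt_ofReal_iff (by positivity)] at hs1
        exact hs1
      by_cases hb0 : b = 0
      · refine ⟨0, le_refl _, ?_, Eventually.of_forall fun n => Or.inl rfl⟩
        rw [hb0] at hs1'; exact_mod_cast hs1'
      · have hb0' : (0 : ℝ) < b := by
          have := pos_iff_ne_zero.mpr hb0
          exact_mod_cast this
        have h3 : max (h / s - 1) 0 < (b : ℝ) := by
          rw [max_lt_iff]
          refine ⟨?_, hb0'⟩
          rw [sub_lt_iff_lt_add, div_lt_iff₀ hs0]; linarith
        obtain ⟨B, hB1, hB2⟩ := exists_between h3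
        rw [max_lt_iff] at hB1
        refine ⟨B, hB1.2.le, ?_, hlt B hB1.2.le ?_⟩
        · have := hB1.1
          rw [sub_lt_iff_lt_add, div_lt_iff₀ hs0] at this; linarith
        · rw [← ENNReal.ofReal_coe_nnreal]
          exact (ENNReal.ofReal_lt_ofReal_iff hb0').mpr hB2
  obtain ⟨B, hB0, hB1, hB2⟩ := hB
  have := bs_upper X h hent ψ B s hB0 hs0 hB1 hB2
  rw [ENNReal.ofReal_coe_nnreal] at this
  exact absurd hs2 (not_lt.mpr this)

theorem bs_lower_final {m : ℕ} [NeZero m] (w : SeqSpace (Fin m)) (hw0 : 0 < w 0)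
    (hself : ∀ j : ℕ, LexLe (shift^[j] w) w) (X : Set (SeqSpace (Fin m)))
    (hX : ∀ x, x ∈ X ↔ ∀ j : ℕ, 1 ≤ j → LexLe (shift^[j] x) w) (h : ℝ)
    (hent : Tendsto (fun n => Real.log ((wordsOfLen (language X) n).ncard) / n)
      atTop (nhds h)) (ψ : ℕ → ℝ) (hψpos : ∀ n, 0 < ψ n) (hψanti : Antitone ψ) (b : ℝ≥0∞)
    (hb : atTop.liminf (fun n : ℕ => ENNReal.ofReal (-Real.log (ψ n) / n)) = b) :
    ENNReal.ofReal h / (1 + b) ≤ dimH (recSet X ψ) := by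
  by_cases hbt : b = ∞
  · simp [hbt]
  lift b to ℝ≥0 using hbt
  refine ENNReal.le_of_forall_nnreal_lt fun r hr => ?_
  by_cases hr0 : r = 0
  · simp [hr0]
  have hr0' : (0 : ℝ) < r := by
    have := pos_iff_ne_zero.mpr hr0
    exact_mod_cast this
  have hrh : r * (1 + b) < h := by
    rw [ENNReal.lt_div_iff_mul_lt (Or.inl (by simp)) (Or.inl (by simp))] at hr
    have e : (r : ℝ≥0∞) * (1 + b) = ENNReal.ofReal (r * (1 + b)) := by
      rw [ENNReal.ofReal_mul (by positivity), ENNReal.ofReal_add (by positivity) (by positivity)]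
      simp
    rw [e] at hr
    by_contra hcon
    exact absurd hr (not_lt.mpr (ENNReal.ofReal_le_ofReal (not_lt.mp hcon)))
  obtain ⟨κ, hκ1, hκ2⟩ := exists_between hrh
  have hκ0 : 0 < κ := lt_trans (by positivity) hκ1
  -- counting
  have hcnt : ∀ᶠ N : ℕ in atTop, κ * N < Real.log ((bsGood w N).ncard) := by
    have hm0 : (m : ℝ) ≠ 0 := by exact_mod_cast NeZero.ne m
    have hlim : Tendsto (fun N : ℕ => Real.log ((wordsOfLen (language X) N).ncard) / N
        - (Real.log m / N + Real.log N / N)) atTop (nhds (h - (0 + 0))) := by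
      refine hent.sub (Tendsto.add ?_ ?_)
      · exact tendsto_const_nhds.div_atTop tendsto_natCast_atTop_atTop
      · exact (Real.isLittleO_log_id_atTop.tendsto_div_nhds_zero).comp tendsto_natCast_atTop_atTop
    rw [add_zero, sub_zero] at hlim
    filter_upwards [hlim.eventually_const_lt hκ2, hent.eventually_const_lt (hκ0.trans hκ2),
      eventually_gt_atTop 0] with N h1 h2 hN
    have hN' : (0 : ℝ) < N := by exact_mod_cast hN
    have hle := bs_count w hw0 hself X (fun x hx => (hX x).mp hx) N hN
    have hpos : 0 < (wordsOfLen (language X) N).ncard := by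
      rcases Nat.eq_zero_or_pos (wordsOfLen (language X) N).ncard with h0 | h0
      · rw [h0] at h2; simp at h2
      · exact h0
    have hgpos : (bsGood w N).ncard ≠ 0 := by
      intro h0; rw [h0] at hle; simp at hle; omega
    have hlog : Real.log ((wordsOfLen (language X) N).ncard)
        ≤ Real.log m + (Real.log N + Real.log ((bsGood w N).ncard)) := by
      rw [← Real.log_mul hN'.ne' (by exact_mod_cast hgpos), ← Real.log_mul hm0
        (mul_ne_zero hN'.ne' (by exact_mod_cast hgpos))]
      exact Real.log_le_log (by exact_mod_cast hpos) (by exact_mod_cast hle)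
    rw [← add_div, ← sub_div, lt_div_iff₀ hN'] at h1
    linarith
  obtain ⟨N, hN, hNpos⟩ := (hcnt.and (eventually_gt_atTop 0)).exists
  have hN' : (0 : ℝ) < N := by exact_mod_cast hNpos
  set l : ℝ := r / κ with hl
  have hl0 : 0 < l := by positivity
  have hlb : l * (1 + b) < 1 := by
    rw [hl, div_mul_eq_mul_div, div_lt_one hκ0]; exact hκ1
  obtain ⟨B, hB1, hB2⟩ : ∃ B : ℝ, (b : ℝ) < B ∧ l * (1 + B) < 1 := by
    have : (b : ℝ) < 1 / l - 1 := by
      rw [lt_sub_iff_add_lt, lt_div_iff₀ hl0]; linarith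
    obtain ⟨B, h1, h2⟩ := exists_between this
    refine ⟨B, h1, ?_⟩
    rw [lt_sub_iff_add_lt, lt_div_iff₀ hl0] at h2; linarith
  have hB0 : 0 < B := lt_of_le_of_lt b.2 hB1
  have hfr : ∃ᶠ n : ℕ in atTop, -Real.log (ψ n) < B * n := by
    have h1 : atTop.liminf (fun n : ℕ => ENNReal.ofReal (-Real.log (ψ n) / n))
        < ENNReal.ofReal B := by
      rw [hb, ← ENNReal.ofReal_coe_nnreal]
      exact (ENNReal.ofReal_lt_ofReal_iff hB0).mpr hB1
    refine ((frequently_lt_of_liminf_lt (h := h1)).and_eventually (eventually_gt_atTop 0)).mono ?_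
    rintro n ⟨hn, hn0⟩
    have hn0' : (0 : ℝ) < n := by exact_mod_cast hn0
    rw [ENNReal.ofReal_lt_ofReal_iff hB0, div_lt_iff₀ hn0'] at hn
    exact hn
  have hM : 1 < (bsGood w N).ncard := by
    by_contra hcon
    have : Real.log ((bsGood w N).ncard) ≤ 0 :=
      Real.log_nonpos (by positivity) (by exact_mod_cast not_lt.mp hcon)
    have : 0 < κ * N := by positivity
    linarith
  have hfin : Finite (bsGood w N) := (bsGood_finite w N).to_subtype
  let eqv : Fin (bsGood w N).ncard ≃ bsGood w N := (Finite.equivFin (bsGood w N)).symm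
  have hmain := bs_lower X ψ N (bsGood w N).ncard hNpos hM (fun a => (eqv a).1) (by
      intro a a' haa
      apply eqv.injective
      apply Subtype.ext
      funext i
      by_cases hi : i < N
      · exact haa i hi
      · rw [(eqv a).2.2 i (by omega), (eqv a').2.2 i (by omega)]) (by
      intro z
      rw [hX]
      intro j _
      exact bs_concat w N hNpos (fun q => (eqv (z q)).1) (fun q => (eqv (z q)).2) j)
      l hl0 (bs_gap ψ hψpos hψanti B l hB0 hl0 hB2 hfr N hNpos)
  refine le_trans ?_ hmain
  rw [← ENNReal.ofReal_coe_nnreal]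
  refine ENNReal.ofReal_le_ofReal ?_
  rw [le_div_iff₀ hN']
  have e : (r : ℝ) = l * κ := by rw [hl]; field_simp
  rw [e, mul_assoc]
  exact mul_le_mul_of_nonneg_left hN.le hl0.le

/-- **Application to β-shifts.** Let `β > 1`, let `w` be the greedy `β`-expansion of 1
(the lexicographically largest sequence with `∑ w_j β^{-j} = 1`), and let `Σ_β` be the
`β`-shift. If `ψ : ℕ → (0,∞)` is nonincreasing, then `dim_H R(ψ) = h/(1+b)` with
`h = h_top(Σ_β)` and `b = liminf (-log ψ(n))/n ∈ [0,∞]`. -/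
theorem dimH_recSet_betaShift
    (β : ℝ) (hβ : 1 < β) (w : SeqSpace (Fin ⌈β⌉₊))
    (hw1 : ∑' j : ℕ, ((w j : ℕ) : ℝ) / β ^ (j + 1) = 1)
    (hwmax : ∀ v : SeqSpace (Fin ⌈β⌉₊),
      (∑' j : ℕ, ((v j : ℕ) : ℝ) / β ^ (j + 1)) = 1 → LexLe v w)
    (h : ℝ)
    (hent : Tendsto
      (fun n => Real.log ((wordsOfLen (language (betaShift β w)) n).ncard) / n)
      atTop (nhds h))
    (ψ : ℕ → ℝ) (hψpos : ∀ n, 0 < ψ n) (hψanti : Antitone ψ)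
    (b : ℝ≥0∞)
    (hb : atTop.liminf (fun n => ENNReal.ofReal (-Real.log (ψ n) / n)) = b) :
    dimH (recSet (betaShift β w) ψ) = ENNReal.ofReal h / (1 + b) := by

  have hm : β ≤ (⌈β⌉₊ : ℝ) := Nat.le_ceil β
  have hne : NeZero ⌈β⌉₊ := ⟨(Nat.ceil_pos.mpr (by linarith)).ne'⟩
  have hh : 0 ≤ h := ge_of_tendsto' hent fun n =>
    div_nonneg (Real.log_natCast_nonneg _) (Nat.cast_nonneg _)
  refine le_antisymm (bs_upper_final _ h hh hent ψ hψpos b hb) ?_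
  exact bs_lower_final w (bs_head_pos hβ hm w hw1 hwmax) (bs_self hβ hm w hw1 hwmax) _
    (fun x => Iff.rfl) h hent ψ hψpos hψanti b hb
end
end

section
/- Let S ⊆ {0,1,2,…} be infinite and let Σ_S be the S-gap shift, with shift map σ and the metric d(u,v) = e^{-|u∧v|}. If ψ : ℕ → (0,∞) is nonincreasing, then the Hausdorff dimension of R(ψ) = {x ∈ Σ_S : d(σ^n x, x) < ψ(n) for infinitely many n} equals h/(1+b), where h = h_top(Σ_S) and b = liminf_{n→∞} (−log ψ(n))/n (with the convention h/(1+b) = 0 when b = ∞). -/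
open Filter MeasureTheory Set
open scoped ENNReal NNReal

noncomputable section

open SeqSpace

/-- The S-gap shift: all binary sequences in which the number of `0`s between any two
consecutive occurrences of `1` lies in `S`. -/
def sGapShift (S : Set ℕ) : Set (SeqSpace (Fin 2)) :=
  {x | ∀ i j : ℕ, i < j → x i = 1 → x j = 1 →
    (∀ k, i < k → k < j → x k = 0) → (j - i - 1) ∈ S}

namespace GapProof

theorem shift_iter {A : Type*} (n : ℕ) (x : SeqSpace A) (p : ℕ) : (shift^[n] x) p = x (p + n) := by
  induction n generalizing x with
  | zero => rfl
  | succ n ih =>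
    rw [Function.iterate_succ_apply, ih]
    show x (p + n + 1) = x (p + (n + 1))
    rfl

theorem dist_eq {A : Type*} {x y : SeqSpace A} (h : x ≠ y) :
    dist x y = Real.exp (-(lcp x y : ℝ)) := by
  show sdist x y = _
  rw [sdist, if_neg h]

theorem dist_le_of_agree {A : Type*} {x y : SeqSpace A} (n : ℕ) (h : ∀ i < n, x i = y i) :
    dist x y ≤ Real.exp (-(n : ℝ)) := by
  by_cases hxy : x = y
  · rw [hxy, dist_self]; exact (Real.exp_pos _).le
  · rw [dist_eq hxy]
    apply Real.exp_le_exp.mpr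
    apply neg_le_neg
    have : n ≤ lcp x y := by
      by_contra hlt
      exact lcp_mem hxy (h _ (not_le.mp hlt))
    exact_mod_cast this

theorem agree_of_lt_lcp {A : Type*} {x y : SeqSpace A} {j : ℕ} (h : j < lcp x y) : x j = y j := by
  by_contra hne
  exact absurd (Nat.sInf_le (show j ∈ {n | x n ≠ y n} from hne)) (not_le.mpr h)

theorem agree_of_dist_lt {A : Type*} {x y : SeqSpace A} {r : ℝ} (hr : 0 < r) (h : dist x y < r)
    (j : ℕ) (hj : (j : ℝ) ≤ -Real.log r) : x j = y j := by
  by_cases hxy : x = y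
  · rw [hxy]
  · rw [dist_eq hxy] at h
    apply agree_of_lt_lcp
    have h1 : -(lcp x y : ℝ) < Real.log r := (Real.lt_log_iff_exp_lt hr).mpr h
    have : (j : ℝ) < lcp x y := by linarith
    exact_mod_cast this

/-- Diameter bound of the covering pieces. -/
theorem piece_dist {A : Type*} {x y : SeqSpace A} {r β : ℝ} (hr : 0 < r) {n : ℕ} (hn : 1 ≤ n)
    (hβ0 : 0 ≤ β) (hβ : β = 0 ∨ β * n ≤ -Real.log r)
    (hx : dist (shift^[n] x) x < r) (hy : dist (shift^[n] y) y < r)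
    (hag : ∀ i < n, x i = y i) :
    dist x y ≤ Real.exp (-((1 + β) * n)) := by
  by_cases hxy : x = y
  · rw [hxy, dist_self]; exact (Real.exp_pos _).le
  rw [dist_eq hxy]
  apply Real.exp_le_exp.mpr
  apply neg_le_neg
  set l := lcp x y with hl
  have hnl : n ≤ l := by
    by_contra hlt
    exact lcp_mem hxy (hag _ (not_le.mp hlt))
  rcases hβ with hβ | hβ
  · subst hβ; simpa using hnl
  by_contra hlt
  push Not at hlt
  obtain ⟨j, hj⟩ := Nat.exists_eq_add_of_le hnl
  have hj' : (l : ℝ) = n + j := by exact_mod_cast hj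
  have hjr : (j : ℝ) ≤ -Real.log r := by nlinarith
  have e1 := agree_of_dist_lt hr hx j hjr
  have e2 := agree_of_dist_lt hr hy j hjr
  rw [shift_iter] at e1 e2
  have e3 : x j = y j := agree_of_lt_lcp (by omega)
  apply lcp_mem hxy
  rw [← hl, hj, add_comm, e1, e2, e3]

theorem wordsOfLen_finite (D : Set (List (Fin 2))) (n : ℕ) : (wordsOfLen D n).Finite :=
  (List.finite_length_eq (Fin 2) n).subset fun _ hw => hw.2

theorem hausdorff_ne_top [MeasurableSpace (SeqSpace (Fin 2))] [BorelSpace (SeqSpace (Fin 2))]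
    (X : Set (SeqSpace (Fin 2))) (ψ : ℕ → ℝ) (hψpos : ∀ n, 0 < ψ n)
    (H β : ℝ) (d : ℝ≥0) (hβ0 : 0 ≤ β) (hd : H < d * (1 + β))
    (hent : ∀ᶠ n : ℕ in atTop, ((wordsOfLen (language X) n).ncard : ℝ) ≤ Real.exp (H * n))
    (hβ : β = 0 ∨ ∀ᶠ n : ℕ in atTop, β * n ≤ -Real.log (ψ n)) :
    Measure.hausdorffMeasure (d : ℝ) (recSet X ψ) ≠ ⊤ := by
  set θ : ℝ := Real.exp (H - d * (1 + β)) with hθ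
  have hθ1 : ENNReal.ofReal θ < 1 := by
    rw [ENNReal.ofReal_lt_one, hθ, Real.exp_lt_one_iff]; linarith
  let ι : ℕ → Type := fun k => Σ n : ℕ, (wordsOfLen (language X) (n + k) : Set (List (Fin 2)))
  have : ∀ k, Countable (ι k) := by
    intro k
    have : ∀ n, Countable (wordsOfLen (language X) (n + k) : Set (List (Fin 2))) := fun n =>
      (wordsOfLen_finite _ _).countable
    infer_instance
  let t : ∀ k, ι k → Set (SeqSpace (Fin 2)) := fun k i =>
    {x | dist (shift^[i.1 + k] x) x < ψ (i.1 + k)} ∩ cyl i.2.1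
  have hev : ∀ᶠ k : ℕ in atTop, ∀ n ≥ k, 1 ≤ n ∧
      ((wordsOfLen (language X) n).ncard : ℝ) ≤ Real.exp (H * n) ∧
      (β = 0 ∨ β * n ≤ -Real.log (ψ n)) := by
    rw [eventually_forall_ge_atTop]
    rcases hβ with hβ | hβ
    · filter_upwards [hent, eventually_ge_atTop 1] with n h1 h2
      exact ⟨h2, h1, Or.inl hβ⟩
    · filter_upwards [hent, hβ, eventually_ge_atTop 1] with n h1 h3 h2
      exact ⟨h2, h1, Or.inr h3⟩
  have hdiam : ∀ᶠ k : ℕ in atTop, ∀ i : ι k,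
      Metric.ediam (t k i) ≤ ENNReal.ofReal (Real.exp (-((1 + β) * ((i.1 + k : ℕ) : ℝ)))) := by
    filter_upwards [hev] with k hk i
    obtain ⟨n, w, hw⟩ := i
    obtain ⟨h1, -, h3⟩ := hk (n + k) (by omega)
    apply Metric.ediam_le
    intro x hx y hy
    rw [edist_dist]
    apply ENNReal.ofReal_le_ofReal
    refine piece_dist (hψpos _) h1 hβ0 h3 hx.1 hy.1 ?_
    intro j hj
    have hlen : w.length = n + k := hw.2
    have a1 := hx.2 j (by simpa [hlen] using hj)
    have a2 := hy.2 j (by simpa [hlen] using hj)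
    simp only [zero_add] at a1 a2
    rw [a1, a2]
  have key := Measure.hausdorffMeasure_le_liminf_tsum (ι := ι) (d : ℝ) (recSet X ψ)
    (l := (atTop : Filter ℕ))
    (fun k => ENNReal.ofReal (Real.exp (-(k : ℝ)))) ?_ t ?_ ?_
  · refine ne_top_of_le_ne_top ?_ (key.trans (?_ : _ ≤ (1 - ENNReal.ofReal θ)⁻¹))
    · exact ENNReal.inv_ne_top.mpr (tsub_pos_of_lt hθ1).ne'
    · apply liminf_le_of_frequently_le'
      apply Eventually.frequently
      filter_upwards [hdiam, hev] with k hk1 hk2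
      rw [ENNReal.tsum_sigma' ]
      rw [← ENNReal.tsum_geometric]
      apply ENNReal.tsum_le_tsum
      intro n
      have hfin := wordsOfLen_finite (language X) (n + k)
      calc ∑' w : (wordsOfLen (language X) (n + k) : Set (List (Fin 2))),
              Metric.ediam (t k ⟨n, w⟩) ^ (d : ℝ)
          ≤ ∑' w : (wordsOfLen (language X) (n + k) : Set (List (Fin 2))),
              ENNReal.ofReal (Real.exp (-(d * (1 + β) * ((n + k : ℕ) : ℝ)))) := by
            apply ENNReal.tsum_le_tsum
            intro w
            refine (ENNReal.rpow_le_rpow (hk1 ⟨n, w⟩) d.2).trans ?_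
            rw [ENNReal.ofReal_rpow_of_pos (Real.exp_pos _), ← Real.exp_mul]
            apply le_of_eq
            congr 2
            simp only [NNReal.val_eq_coe]
            ring
        _ = ENNReal.ofReal ((wordsOfLen (language X) (n + k)).ncard) *
              ENNReal.ofReal (Real.exp (-(d * (1 + β) * ((n + k : ℕ) : ℝ)))) := by
            rw [ENNReal.tsum_set_const, ENNReal.ofReal_natCast, hfin.encard_eq_coe_toFinset_card,
              Set.ncard_eq_toFinset_card _ hfin]
            rfl
        _ ≤ ENNReal.ofReal (Real.exp (H * ((n + k : ℕ) : ℝ))) *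
              ENNReal.ofReal (Real.exp (-(d * (1 + β) * ((n + k : ℕ) : ℝ)))) := by
            gcongr
            exact (hk2 (n + k) (by omega)).2.1
        _ = ENNReal.ofReal θ ^ (n + k) := by
            rw [← ENNReal.ofReal_mul (Real.exp_pos _).le, ← ENNReal.ofReal_pow (Real.exp_pos _).le,
              ← Real.exp_nat_mul, ← Real.exp_add]
            congr 2
            ring
        _ ≤ ENNReal.ofReal θ ^ n := pow_le_pow_right_of_le_one' hθ1.le (by omega)
  · rw [← ENNReal.ofReal_zero]
    apply ENNReal.tendsto_ofReal
    exact Real.tendsto_exp_neg_atTop_nhds_zero.comp tendsto_natCast_atTop_atTop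
  · filter_upwards [hdiam] with k hk i
    refine (hk i).trans (ENNReal.ofReal_le_ofReal (Real.exp_le_exp.mpr ?_))
    have : (0 : ℝ) ≤ i.1 := by positivity
    push_cast
    have hk0 : (0 : ℝ) ≤ k := by positivity
    nlinarith [mul_nonneg hβ0 this, mul_nonneg hβ0 hk0]
  · refine Eventually.of_forall fun k x hx => ?_
    obtain ⟨hxX, hxf⟩ := hx
    obtain ⟨n, hn, hxn⟩ := (frequently_atTop.mp hxf) k
    obtain ⟨m, rfl⟩ := Nat.exists_eq_add_of_le' hn
    refine mem_iUnion.mpr ⟨⟨m, ⟨List.ofFn fun i : Fin (m + k) => x i, ?_, by simp⟩⟩, hxn, ?_⟩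
    · refine ⟨x, hxX, 0, ?_⟩
      intro i hi
      simp
    · intro i hi
      simp

theorem upper (X : Set (SeqSpace (Fin 2))) (h : ℝ)
    (hent : Tendsto
      (fun n => Real.log ((wordsOfLen (language X) n).ncard) / n)
      atTop (nhds h))
    (ψ : ℕ → ℝ) (hψpos : ∀ n, 0 < ψ n)
    (b : ℝ≥0∞)
    (hb : atTop.liminf (fun n => ENNReal.ofReal (-Real.log (ψ n) / n)) = b) :
    dimH (recSet X ψ) ≤ ENNReal.ofReal h / (1 + b) := by
  by_contra hlt
  push Not at hlt
  obtain ⟨d, hd1, hd2⟩ := ENNReal.lt_iff_exists_nnreal_btwn.mp hlt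
  have hd0 : (0 : ℝ) < d := by
    have := (zero_le).trans_lt hd1
    exact_mod_cast this
  rw [ENNReal.div_lt_iff (Or.inl (by simp)) (Or.inr (by simp))] at hd1
  have hβ : ∃ β : ℝ≥0, h < d * (1 + β) ∧ (β = 0 ∨ (β : ℝ≥0∞) < b) := by
    by_cases hhd : h < d
    · exact ⟨0, by simpa using hhd, Or.inl rfl⟩
    push Not at hhd
    have h1 : (1 : ℝ) ≤ h / d := by rwa [le_div_iff₀ hd0, one_mul]
    have hlt : ENNReal.ofReal (h / d - 1) < b := by
      by_contra hle
      push Not at hle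
      apply absurd hd1
      push Not
      calc (d : ℝ≥0∞) * (1 + b) ≤ d * (1 + ENNReal.ofReal (h / d - 1)) := by gcongr
        _ = ENNReal.ofReal d * (ENNReal.ofReal 1 + ENNReal.ofReal (h / d - 1)) := by simp
        _ = ENNReal.ofReal h := by
          rw [← ENNReal.ofReal_add (by norm_num) (by linarith), ← ENNReal.ofReal_mul hd0.le]
          congr 1
          field_simp
          ring
    obtain ⟨β, hβ1, hβ2⟩ := ENNReal.lt_iff_exists_nnreal_btwn.mp hlt
    refine ⟨β, ?_, Or.inr hβ2⟩
    rw [ENNReal.ofReal_lt_coe_iff (by positivity)] at hβ1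
    have : h / d < 1 + β := by linarith
    rw [div_lt_iff₀ hd0] at this
    linarith
  obtain ⟨β, hβ1, hβ2⟩ := hβ
  obtain ⟨H, hH1, hH2⟩ := exists_between hβ1
  borelize (SeqSpace (Fin 2))
  refine absurd (dimH_le_of_hausdorffMeasure_ne_top
    (hausdorff_ne_top X ψ hψpos H β d β.2 hH2 ?_ ?_)) (not_le.mpr hd2)
  · filter_upwards [hent.eventually (gt_mem_nhds hH1), eventually_ge_atTop 1] with n hn hn1
    have hn0 : (0 : ℝ) < n := by exact_mod_cast hn1
    rw [div_lt_iff₀ hn0] at hn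
    rcases Nat.eq_zero_or_pos (wordsOfLen (language X) n).ncard with h0 | h0
    · rw [h0]; simpa using (Real.exp_pos _).le
    · rw [← Real.log_le_iff_le_exp (by exact_mod_cast h0)]
      exact hn.le
  · rcases hβ2 with hβ2 | hβ2
    · left; simp [hβ2]
    · right
      rw [← hb] at hβ2
      filter_upwards [eventually_lt_of_lt_liminf hβ2, eventually_ge_atTop 1] with n hn hn1
      have hn0 : (0 : ℝ) < n := by exact_mod_cast hn1
      rw [ENNReal.lt_ofReal_iff_toReal_lt (by simp)] at hn
      rw [ENNReal.coe_toReal, lt_div_iff₀ hn0] at hn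
      exact hn.le

end GapProof
namespace GapProof

/-- Words `1 w` of length `k+1`, starting and ending with `1`, all gaps in `S`. -/
def T (S : Set ℕ) (k : ℕ) : Set (Fin (k + 1) → Fin 2) :=
  {v | v 0 = 1 ∧ v (Fin.last k) = 1 ∧ ∀ i j : Fin (k + 1), i < j → v i = 1 → v j = 1 →
    (∀ l, i < l → l < j → v l = 0) → ((j : ℕ) - i - 1) ∈ S}

open scoped Classical in
/-- Pad a word by zeros. -/
def pad (n a k : ℕ) (v : Fin (k + 1) → Fin 2) : List (Fin 2) :=
  List.ofFn fun i : Fin n => if h : a ≤ i ∧ (i : ℕ) - a < k + 1 then v ⟨(i : ℕ) - a, h.2⟩ else 0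

theorem words_subset (S : Set ℕ) (n : ℕ) :
    wordsOfLen (language (sGapShift S)) n ⊆
      {List.replicate n 0} ∪
        ⋃ p ∈ (Finset.range n ×ˢ Finset.range n : Finset (ℕ × ℕ)), pad n p.1 p.2 '' T S p.2 := by
  classical
  rintro w ⟨⟨x, hx, p, hw⟩, hlen⟩
  by_cases h0 : ∃ i, i < n ∧ x (p + i) = 1
  · right
    have hne : (Finset.filter (fun i => x (p + i) = 1) (Finset.range n)).Nonempty := by
      obtain ⟨i, hi, hi'⟩ := h0
      exact ⟨i, by simp [hi, hi']⟩
    set Fs := Finset.filter (fun i => x (p + i) = 1) (Finset.range n) with hFs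
    have ha := Finset.min'_mem Fs hne
    have he := Finset.max'_mem Fs hne
    have hae : Fs.min' hne ≤ Fs.max' hne := Finset.min'_le _ _ he
    have hmin : ∀ i, i < n → x (p + i) = 1 → Fs.min' hne ≤ i ∧ i ≤ Fs.max' hne := by
      intro i hi hi'
      have : i ∈ Fs := by simp [hFs, hi, hi']
      exact ⟨Finset.min'_le _ _ this, Finset.le_max' _ _ this⟩
    set a := Fs.min' hne
    set e := Fs.max' hne
    simp only [hFs, Finset.mem_filter, Finset.mem_range] at ha he
    have hval : ∀ i, i < n → (a ≤ i ∧ i ≤ e) ∨ x (p + i) = 0 := by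
      intro i hi
      by_cases h1 : x (p + i) = 1
      · exact Or.inl (hmin i hi h1)
      · right; omega
    simp only [mem_iUnion, mem_image]
    refine ⟨(a, e - a), by simp; omega, fun i => x (p + a + i), ⟨?_, ?_, ?_⟩, ?_⟩
    · simpa using ha.2
    · have : p + a + (e - a) = p + e := by omega
      simpa [this] using he.2
    · intro i j hij hi hj hl
      have := hx (p + a + i) (p + a + j) (by have : (i : ℕ) < j := hij; omega) hi hj ?_
      · have e1 : p + a + (j : ℕ) - (p + a + i) - 1 = (j : ℕ) - i - 1 := by omega
        rwa [e1] at this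
      · intro k hk1 hk2
        have := hl ⟨k - (p + a), by have := j.2; omega⟩
          (by show (i : ℕ) < k - (p + a); omega) (by show k - (p + a) < (j : ℕ); omega)
        have e1 : p + a + (k - (p + a)) = k := by omega
        simpa [e1] using this
    · apply List.ext_getElem
      · simp [pad, hlen]
      · intro i h1 h2
        have hi : i < n := by rw [hlen] at h2; exact h2
        rw [← hw i h2]
        simp only [pad, List.getElem_ofFn]
        split_ifs with hc
        · congr 1; omega
        · rcases hval i hi with h3 | h3
          · exact absurd ⟨h3.1, by omega⟩ hc
          · exact h3.symm
  · left
    push Not at h0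
    rw [mem_singleton_iff, List.eq_replicate_iff]
    refine ⟨hlen, ?_⟩
    intro c hc
    obtain ⟨i, hi, rfl⟩ := List.getElem_of_mem hc
    rw [← hw i hi]
    have := h0 i (by omega)
    omega

theorem ncard_words_le (S : Set ℕ) (n : ℕ) :
    (wordsOfLen (language (sGapShift S)) n).ncard ≤
      1 + ∑ p ∈ (Finset.range n ×ˢ Finset.range n : Finset (ℕ × ℕ)), (T S p.2).ncard := by
  have hfin : ∀ p : ℕ × ℕ, (pad n p.1 p.2 '' T S p.2).Finite := fun p => (Set.toFinite _).image _
  refine (Set.ncard_le_ncard (words_subset S n) ?_).trans ?_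
  · refine (Set.finite_singleton _).union ?_
    exact Set.Finite.biUnion (Finset.finite_toSet _) fun p _ => hfin p
  · refine (Set.ncard_union_le _ _).trans ?_
    gcongr
    · simp
    · refine (Finset.set_ncard_biUnion_le _ _).trans ?_
      exact Finset.sum_le_sum fun p _ => Set.ncard_image_le (Set.toFinite _)

theorem exists_block (S : Set ℕ) (h h' : ℝ)
    (hent : Tendsto
      (fun n => Real.log ((wordsOfLen (language (sGapShift S)) n).ncard) / n)
      atTop (nhds h)) (h'0 : 0 < h') (hh : h' < h) :
    ∃ N : ℕ, 1 ≤ N ∧ Real.exp (N * h') ≤ (T S N).ncard := by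
  by_contra hcon
  push Not at hcon
  have hT : ∀ k, ((T S k).ncard : ℝ) ≤ Real.exp (k * h') := by
    intro k
    rcases Nat.eq_zero_or_pos k with rfl | hk
    · have : (T S 0).ncard ≤ 1 := by
        rw [Set.ncard_le_one (Set.toFinite _)]
        intro a ha b hb
        funext i
        have : i = 0 := by omega
        rw [this, ha.1, hb.1]
      simpa using this
    · exact (hcon k hk).le
  have hle : ∀ n : ℕ, 1 ≤ n → ((wordsOfLen (language (sGapShift S)) n).ncard : ℝ) ≤
      2 * (n : ℝ) ^ 2 * Real.exp (n * h') := by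
    intro n hn
    have h1 : ((wordsOfLen (language (sGapShift S)) n).ncard : ℝ) ≤
      1 + ∑ p ∈ (Finset.range n ×ˢ Finset.range n : Finset (ℕ × ℕ)), ((T S p.2).ncard : ℝ) := by
      exact_mod_cast ncard_words_le S n
    have h2 : ∑ p ∈ (Finset.range n ×ˢ Finset.range n : Finset (ℕ × ℕ)), ((T S p.2).ncard : ℝ)
        ≤ ∑ p ∈ (Finset.range n ×ˢ Finset.range n : Finset (ℕ × ℕ)), Real.exp (n * h') := by
      apply Finset.sum_le_sum
      intro p hp
      simp only [Finset.mem_product, Finset.mem_range] at hp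
      refine (hT _).trans (Real.exp_le_exp.mpr ?_)
      have : (p.2 : ℝ) ≤ n := by exact_mod_cast hp.2.le
      gcongr
    rw [Finset.sum_const, Finset.card_product, Finset.card_range, nsmul_eq_mul] at h2
    push_cast at h2
    have hn' : (1 : ℝ) ≤ n := by exact_mod_cast hn
    have h3 : (1 : ℝ) ≤ Real.exp (n * h') := Real.one_le_exp (by positivity)
    have h4 : (1 : ℝ) ≤ (n : ℝ) ^ 2 * Real.exp (n * h') := by
      have : (1 : ℝ) ≤ (n : ℝ) ^ 2 := one_le_pow₀ hn'
      nlinarith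
    nlinarith
  have hpos : ∀ n, 0 < (wordsOfLen (language (sGapShift S)) n).ncard := by
    intro n
    rw [Set.ncard_pos (wordsOfLen_finite _ _)]
    refine ⟨List.replicate n 0, ⟨fun _ => 0, ?_, 0, ?_⟩, by simp⟩
    · intro i j _ hi
      exact absurd (show (0 : Fin 2) = 1 from hi) (by decide)
    · intro i hi
      simp
  have hlim : Tendsto (fun n : ℕ => Real.log 2 / n + 2 * (Real.log n / n) + h') atTop
      (nhds (0 + 2 * 0 + h')) := by
    have l1 : Tendsto (fun n : ℕ => Real.log 2 / (n : ℝ)) atTop (nhds 0) :=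
      tendsto_const_div_atTop_nhds_zero_nat _
    have l2 : Tendsto (fun n : ℕ => Real.log n / (n : ℝ)) atTop (nhds 0) := by
      have := Real.isLittleO_log_id_atTop.tendsto_div_nhds_zero
      exact this.comp tendsto_natCast_atTop_atTop
    exact (l1.add (l2.const_mul 2)).add_const h'
  have := le_of_tendsto_of_tendsto hent hlim ?_
  · linarith
  · filter_upwards [eventually_ge_atTop 1] with n hn
    have hn' : (0 : ℝ) < n := by exact_mod_cast hn
    rw [div_le_iff₀ hn']
    refine (Real.log_le_log (by exact_mod_cast hpos n) (hle n hn)).trans ?_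
    rw [Real.log_mul (by positivity) (by positivity), Real.log_mul (by positivity) (by positivity),
      Real.log_pow, Real.log_exp]
    apply le_of_eq
    field_simp
    push_cast
    ring

end GapProof
namespace GapProof

open scoped Classical in
/-- Root function: follow the copies down to a free position. -/
def rtf (F : ℕ → Prop) (d : ℕ → ℕ) : ℕ → ℕ
  | i => if F i then Nat.count F i else if d i < i then rtf F d (d i) else 0
termination_by i => i

theorem exists_rt (r : ℕ → ℕ) (hr : ∀ q, 1 ≤ r q) (γ : ℝ) (hγ1 : γ ≤ 1)
    (hγ0 : 0 ≤ γ) (good : ℕ → Prop)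
    (hstep : ∀ p : ℕ, ∃ q : ℕ, p ≤ q ∧ 1 ≤ q ∧ good q ∧ γ * ((q : ℝ) + r q) ≤ (q : ℝ) - p) :
    ∃ rt : ℕ → ℕ, (∀ t : ℕ, ∃ c : ℕ, γ * t ≤ c ∧ ∀ j < c, ∃ i < t, rt i = j) ∧
      (∀ m, ∃ q ≥ m, good q ∧ ∀ i < r q, rt (q + i) = rt i) := by
  classical
  choose nxt hn1 hn2 hn3 hn4 using hstep
  obtain ⟨P, P0, PS⟩ : ∃ P : ℕ → ℕ, P 0 = 0 ∧ ∀ k, P (k + 1) = nxt (P k) + r (nxt (P k)) :=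
    ⟨fun k => Nat.rec 0 (fun _ p => nxt p + r (nxt p)) k, rfl, fun _ => rfl⟩
  have hmono : StrictMono P := strictMono_nat_of_lt_succ fun k => by
    rw [PS]; have := hn1 (P k); have := hr (nxt (P k)); omega
  have hκ : ∀ i, ∃ k, P k ≤ i ∧ i < P (k + 1) := by
    intro i
    refine ⟨Nat.findGreatest (fun k => P k ≤ i) i, ?_, ?_⟩
    · have h0 : P 0 ≤ i := by simp [P0]
      exact Nat.findGreatest_spec (P := fun k => P k ≤ i) (Nat.zero_le i) h0
    · by_contra hlt
      push Not at hlt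
      have h1 : Nat.findGreatest (fun k => P k ≤ i) i + 1 ≤ i := (hmono.le_apply).trans hlt
      have h2 := Nat.le_findGreatest (P := fun k => P k ≤ i) h1 hlt
      omega
  choose κ hκ1 hκ2 using hκ
  have huniq : ∀ i k, P k ≤ i → i < P (k + 1) → κ i = k := by
    intro i k h1 h2
    have a1 := hκ1 i
    have a2 := hκ2 i
    have b1 : k < κ i + 1 := hmono.lt_iff_lt.mp (h1.trans_lt a2)
    have b2 : κ i < k + 1 := hmono.lt_iff_lt.mp (a1.trans_lt h2)
    omega
  obtain ⟨F, hF⟩ : ∃ F : ℕ → Prop, ∀ i, F i ↔ i < nxt (P (κ i)) := ⟨_, fun _ => Iff.rfl⟩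
  let d : ℕ → ℕ := fun i => i - nxt (P (κ i))
  refine ⟨rtf F d, ?_, ?_⟩
  · intro t
    refine ⟨Nat.count F t, ?_, ?_⟩
    · induction t with
      | zero => simp
      | succ t ih =>
        by_cases ht : F t
        · rw [Nat.count_succ, if_pos ht]
          push_cast
          linarith
        · have hq : nxt (P (κ t)) ≤ t := by rwa [hF, not_lt] at ht
          have h1 : Nat.count F (nxt (P (κ t))) ≤ Nat.count F (t + 1) :=
            Nat.count_monotone _ (by omega)
          have h2 : nxt (P (κ t)) - P (κ t) ≤ Nat.count F (nxt (P (κ t))) := by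
            obtain ⟨e, he⟩ := Nat.exists_eq_add_of_le (hn1 (P (κ t)))
            have h3 : Nat.count (fun k => F (P (κ t) + k)) e = e := by
              rw [Nat.count_iff_forall]
              intro l hl
              have h4 : κ (P (κ t) + l) = κ t := by
                apply huniq _ _ (by omega)
                rw [PS]; omega
              rw [hF, h4]; omega
            conv_rhs => rw [he, Nat.count_add]
            rw [h3]; omega
          have h5 := hn4 (P (κ t))
          have h6 : t + 1 ≤ nxt (P (κ t)) + r (nxt (P (κ t))) := by
            have := hκ2 t
            rw [PS] at this
            omega
          have h6' : ((t + 1 : ℕ) : ℝ) ≤ (nxt (P (κ t)) : ℝ) + r (nxt (P (κ t))) := by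
            exact_mod_cast h6
          have h7 : nxt (P (κ t)) ≤ Nat.count F (t + 1) + P (κ t) := by omega
          have h7' : (nxt (P (κ t)) : ℝ) ≤ ((Nat.count F (t + 1) : ℕ) : ℝ) + ((P (κ t) : ℕ) : ℝ) := by exact_mod_cast h7
          have := mul_le_mul_of_nonneg_left h6' hγ0
          linarith
    · intro j hj
      have hex : ∃ i, F i ∧ Nat.count F i = j ∧ i < t := by
        induction t with
        | zero => simp at hj
        | succ t ih =>
          rw [Nat.count_succ] at hj
          by_cases ht : F t
          · rw [if_pos ht] at hj
            by_cases hj' : j < Nat.count F t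
            · obtain ⟨i, h1, h2, h3⟩ := ih hj'
              exact ⟨i, h1, h2, by omega⟩
            · exact ⟨t, ht, by omega, by omega⟩
          · rw [if_neg ht] at hj
            obtain ⟨i, h1, h2, h3⟩ := ih (by omega)
            exact ⟨i, h1, h2, by omega⟩
      obtain ⟨i, h1, h2, h3⟩ := hex
      refine ⟨i, h3, ?_⟩
      rw [rtf, if_pos h1, ← h2]
  · intro m
    refine ⟨nxt (P m), (hmono.le_apply).trans (hn1 _), hn3 _, ?_⟩
    intro i hi
    have h4 : κ (nxt (P m) + i) = m := by
      apply huniq _ _ (by have := hn1 (P m); omega)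
      rw [PS]; omega
    have hd : d (nxt (P m) + i) = i := by
      show nxt (P m) + i - nxt (P (κ (nxt (P m) + i))) = i
      rw [h4]; omega
    rw [rtf, if_neg, hd, if_pos]
    · have := hn2 (P m); omega
    · rw [hF, h4]; omega

/-- Concatenation of blocks. -/
def blk {M : ℕ} (N : ℕ) (w : Fin M → Fin (N + 1) → Fin 2) (y : ℕ → Fin M) : SeqSpace (Fin 2) :=
  fun p => w (y (p / N)) (Fin.ofNat (N + 1) (p % N + 1))

theorem blk_apply {M : ℕ} (N : ℕ) (hN : 1 ≤ N) (w : Fin M → Fin (N + 1) → Fin 2) (y : ℕ → Fin M)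
    (q a : ℕ) (ha : a < N) : blk N w y (N * q + a) = w (y q) ⟨a + 1, by omega⟩ := by
  unfold blk
  have h1 : (N * q + a) / N = q := by
    rw [Nat.mul_add_div (by omega), Nat.div_eq_of_lt ha, add_zero]
  have h2 : (N * q + a) % N = a := by rw [Nat.mul_add_mod, Nat.mod_eq_of_lt ha]
  rw [h1, h2]
  congr 1
  ext
  simp [Fin.ofNat]
  exact ha

/-- Shifted reading: position `N*q+a-1` with `a ≤ N`. -/
theorem blk_apply' {S : Set ℕ} {M : ℕ} (N : ℕ) (hN : 1 ≤ N) (w : Fin M → Fin (N + 1) → Fin 2)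
    (hw : ∀ m, w m ∈ T S N) (y : ℕ → Fin M) (i q a : ℕ) (ha : a ≤ N) (hi : i + 1 = N * q + a) :
    blk N w y i = w (y q) ⟨a, by omega⟩ := by
  rcases Nat.eq_zero_or_pos a with rfl | ha0
  · obtain ⟨q', rfl⟩ : ∃ q', q = q' + 1 := by
      rcases q with _ | q'
      · simp at hi
      · exact ⟨q', rfl⟩
    have e : i = N * q' + (N - 1) := by rw [Nat.mul_add] at hi; omega
    have e2 := blk_apply N hN w y q' (N - 1) (by omega)
    rw [← e] at e2
    refine e2.trans ?_
    have h1 := (hw (y (q' + 1))).1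
    have h2 := (hw (y q')).2.1
    have e1 : (⟨N - 1 + 1, by omega⟩ : Fin (N + 1)) = Fin.last N := by ext; simp; omega
    rw [e1, h2]
    exact h1.symm
  · have e : i = N * q + (a - 1) := by omega
    have e2 := blk_apply N hN w y q (a - 1) (by omega)
    rw [← e] at e2
    refine e2.trans ?_
    congr 1
    ext
    simp
    omega

theorem blk_mem {S : Set ℕ} {M : ℕ} (N : ℕ) (hN : 1 ≤ N) (w : Fin M → Fin (N + 1) → Fin 2)
    (hw : ∀ m, w m ∈ T S N) (y : ℕ → Fin M) : blk N w y ∈ sGapShift S := by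
  intro i j hij hi hj hz
  set q := (i + 1) / N with hq
  set a := (i + 1) % N with ha
  have hia : i + 1 = N * q + a := (Nat.div_add_mod (i + 1) N).symm
  have haN : a < N := Nat.mod_lt _ (by omega)
  have hjN : j + 1 ≤ N * q + N := by
    by_contra hlt
    push Not at hlt
    have h1 := hz (N * q + (N - 1)) (by omega) (by omega)
    rw [blk_apply' N hN w hw y _ q N le_rfl (by omega)] at h1
    have h2 := (hw (y q)).2.1
    have h3 : (⟨N, by omega⟩ : Fin (N + 1)) = Fin.last N := rfl
    rw [h3, h2] at h1
    exact absurd h1 (by decide)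
  obtain ⟨c, hc⟩ := Nat.exists_eq_add_of_le (show N * q ≤ j + 1 by omega)
  rw [blk_apply' N hN w hw y i q a haN.le hia] at hi
  rw [blk_apply' N hN w hw y j q c (by omega) hc] at hj
  have := (hw (y q)).2.2 ⟨a, by omega⟩ ⟨c, by omega⟩ (by show a < c; omega) hi hj ?_
  · have e : j - i - 1 = c - a - 1 := by omega
    rw [e]; exact this
  · rintro ⟨l, hl⟩ h1 h2
    have h1' : a < l := h1
    have h2' : l < c := h2
    have := hz (N * q + l - 1) (by omega) (by omega)
    rwa [blk_apply' N hN w hw y _ q l (by omega) (by omega)] at this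

theorem lower_core (S : Set ℕ) (ψ : ℕ → ℝ) (hψpos : ∀ n, 0 < ψ n) (N : ℕ) (hN : 1 ≤ N)
    (h' : ℝ) (h'0 : 0 < h') (hT : Real.exp (N * h') ≤ (T S N).ncard)
    (β : ℝ) (hβ : 0 ≤ β) (hgood : ∃ᶠ q : ℕ in atTop, -Real.log (ψ (N * q)) ≤ N * q * β)
    (c : ℝ≥0) (hc0 : 0 < c) (hc : c * (1 + β) < h') :
    (c : ℝ≥0∞) ≤ dimH (recSet (sGapShift S) ψ) := by
  classical
  have hN0 : (0 : ℝ) < N := by exact_mod_cast hN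
  set γ : ℝ := c / h' with hγ
  have hγ0 : 0 ≤ γ := by positivity
  have hγβ : γ * (1 + β) < 1 := by
    rw [hγ, div_mul_eq_mul_div, div_lt_one h'0]; exact hc
  have hγ1 : γ ≤ 1 := by nlinarith [mul_nonneg hγ0 hβ]
  obtain ⟨rt, hrt1, hrt2⟩ := exists_rt (fun q => ⌈(q : ℝ) * β⌉₊ + 1) (fun q => by simp) γ hγ1 hγ0
    (fun q => -Real.log (ψ (N * q)) ≤ N * q * β) (by
      intro p
      have hev : ∀ᶠ q : ℕ in atTop, ((p : ℝ) + 2) / (1 - γ * (1 + β)) ≤ q :=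
        tendsto_natCast_atTop_atTop.eventually_ge_atTop _
      obtain ⟨q, hq1, hq2, hq3⟩ :=
        (hgood.and_eventually (hev.and (eventually_ge_atTop (p + 1)))).exists
      refine ⟨q, by omega, by omega, hq1, ?_⟩
      rw [div_le_iff₀ (by linarith)] at hq2
      have h1 : ((⌈(q : ℝ) * β⌉₊ : ℕ) : ℝ) < q * β + 1 := Nat.ceil_lt_add_one (by positivity)
      push_cast
      have h2 : γ * ((q : ℝ) + (⌈(q : ℝ) * β⌉₊ + 1)) ≤ γ * (q + (q * β + 1 + 1)) := by gcongr
      nlinarith)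
  have hTfin : (T S N).Finite := Set.toFinite _
  set M := (T S N).ncard with hM
  have hM1 : 1 < M := by
    have : (1 : ℝ) < Real.exp (N * h') := Real.one_lt_exp_iff.mpr (by positivity)
    exact_mod_cast this.trans_le hT
  have hM0 : NeZero M := ⟨by omega⟩
  have hcard : Fintype.card (T S N) = M := by rw [hM, ← Nat.card_coe_set_eq, Nat.card_eq_fintype_card]
  let eqv : Fin M ≃ T S N := (Fintype.equivFinOfCardEq hcard).symm
  let w : Fin M → Fin (N + 1) → Fin 2 := fun m => (eqv m).1
  have hw : ∀ m, w m ∈ T S N := fun m => (eqv m).2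
  have hwinj : Function.Injective w := Subtype.val_injective.comp eqv.injective
  let g : (ℕ → Fin M) → SeqSpace (Fin 2) := fun z => blk N w (fun i => z (rt i))
  have hg : ∀ z, g z ∈ recSet (sGapShift S) ψ := by
    intro z
    refine ⟨blk_mem N hN w hw _, ?_⟩
    rw [frequently_atTop]
    intro m
    obtain ⟨q, hqm, hq, hcopy⟩ := hrt2 m
    refine ⟨N * q, by nlinarith, ?_⟩
    have hag : ∀ p < N * (⌈(q : ℝ) * β⌉₊ + 1), (shift^[N * q] (g z)) p = g z p := by
      intro p hp
      rw [shift_iter]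
      show w (z (rt ((p + N * q) / N))) (Fin.ofNat (N + 1) ((p + N * q) % N + 1)) =
        w (z (rt (p / N))) (Fin.ofNat (N + 1) (p % N + 1))
      rw [Nat.add_mul_div_left _ _ (by omega), Nat.add_mul_mod_self_left, add_comm (p / N),
        hcopy (p / N) (by rw [Nat.div_lt_iff_lt_mul (by omega)]; linarith)]
    refine (dist_le_of_agree _ hag).trans_lt ?_
    rw [← Real.lt_log_iff_exp_lt (hψpos _)]
    push_cast
    have h1 := Nat.le_ceil ((q : ℝ) * β)
    nlinarith
  -- Hölder estimate
  have hhol : ∀ z z' : ℕ → Fin M, |Real.ofDigits z - Real.ofDigits z'| ≤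
      Real.exp (c * N) * dist (g z) (g z') ^ (c : ℝ) := by
    intro z z'
    have main : ∀ t : ℕ, (∀ p < N * t, g z p = g z' p) →
        |Real.ofDigits z - Real.ofDigits z'| ≤ Real.exp (-(c * (N * t))) := by
      intro t ht
      obtain ⟨k, hk, hk2⟩ := hrt1 t
      have hzz : ∀ j < k, z j = z' j := by
        intro j hj
        obtain ⟨i, hi, rfl⟩ := hk2 j hj
        apply hwinj
        funext a
        rcases Nat.eq_zero_or_pos a.1 with h0 | h0
        · have : a = 0 := Fin.ext h0
          rw [this, (hw _).1, (hw _).1]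
        · have hb : N * i + N ≤ N * t := by
            have : N * (i + 1) ≤ N * t := Nat.mul_le_mul_left _ hi
            linarith
          have := ht (N * i + (a.1 - 1)) (by have := a.2; omega)
          have h1 : g z (N * i + (a.1 - 1)) = w (z (rt i)) a := by
            exact blk_apply' N hN w hw _ _ i a.1 (by have := a.2; omega) (by omega)
          have h2 : g z' (N * i + (a.1 - 1)) = w (z' (rt i)) a := by
            exact blk_apply' N hN w hw _ _ i a.1 (by have := a.2; omega) (by omega)
          rw [← h1, ← h2, this]
      refine (Real.abs_ofDigits_sub_ofDigits_le hzz).trans ?_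
      rw [Real.exp_neg]
      apply inv_anti₀ (Real.exp_pos _)
      calc Real.exp (c * (N * t)) ≤ Real.exp (k * (N * h')) := by
            apply Real.exp_le_exp.mpr
            have : (c : ℝ) = γ * h' := by rw [hγ]; field_simp
            rw [this]
            have := mul_le_mul_of_nonneg_right hk (show 0 ≤ N * h' by positivity)
            linarith
        _ = Real.exp (N * h') ^ k := by rw [Real.exp_nat_mul]
        _ ≤ (M : ℝ) ^ k := by gcongr
    by_cases hgz : g z = g z'
    · have hlim : Tendsto (fun t : ℕ => Real.exp (-((c : ℝ) * (N * t)))) atTop (nhds 0) := by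
        apply Real.tendsto_exp_neg_atTop_nhds_zero.comp
        apply Tendsto.const_mul_atTop (by exact_mod_cast hc0)
        apply Tendsto.const_mul_atTop hN0
        exact tendsto_natCast_atTop_atTop
      have := ge_of_tendsto hlim (Eventually.of_forall fun t => main t (fun p _ => by rw [hgz]))
      exact this.trans (by positivity)
    · rw [dist_eq hgz, ← Real.exp_mul, ← Real.exp_add]
      set l := lcp (g z) (g z')
      refine (main (l / N) ?_).trans (Real.exp_le_exp.mpr ?_)
      · intro p hp
        exact agree_of_lt_lcp (hp.trans_le (Nat.mul_div_le _ _))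
      · have h1 : l < N * (l / N) + N := by
          have := Nat.div_add_mod l N
          have := Nat.mod_lt l (show 0 < N by omega)
          omega
        have h1' : (l : ℝ) ≤ N * ((l / N : ℕ) : ℝ) + N := by exact_mod_cast h1.le
        have := mul_le_mul_of_nonneg_left h1' c.2
        simp only [NNReal.val_eq_coe] at this
        linarith
  let f : SeqSpace (Fin 2) → ℝ := fun x => Real.ofDigits (Function.invFun g x)
  have hfg : ∀ z, f (g z) = Real.ofDigits z := by
    intro z
    have h1 : g (Function.invFun g (g z)) = g z := Function.invFun_eq ⟨z, rfl⟩
    have h2 := hhol (Function.invFun g (g z)) z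
    rw [h1, dist_self, Real.zero_rpow (by exact_mod_cast hc0.ne'), mul_zero] at h2
    exact sub_eq_zero.mp (abs_nonpos_iff.mp h2)
  have hH : HolderOnWith (Real.toNNReal (Real.exp (c * N))) c f (range g) := by
    rintro _ ⟨z, rfl⟩ _ ⟨z', rfl⟩
    rw [hfg, hfg, edist_dist, edist_dist, Real.dist_eq,
      ENNReal.ofReal_rpow_of_nonneg dist_nonneg c.coe_nonneg]
    change _ ≤ ENNReal.ofReal _ * _
    rw [← ENNReal.ofReal_mul (Real.exp_pos _).le]
    exact ENNReal.ofReal_le_ofReal (hhol z z')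
  have hdim := hH.dimH_image_le hc0
  have h1 : (1 : ℝ≥0∞) ≤ dimH (f '' range g) := by
    have hsub : Ico (0 : ℝ) 1 ⊆ f '' range g := by
      intro x hx
      refine ⟨g (Real.digits x M), ⟨_, rfl⟩, ?_⟩
      rw [hfg]
      exact Real.ofDigits_digits hM1 hx
    refine le_trans ?_ (dimH_mono hsub)
    rw [Real.dimH_of_nonempty_interior]
    · simp
    · rw [interior_Ico]; exact ⟨1 / 2, by norm_num, by norm_num⟩
  have h2 : (1 : ℝ≥0∞) ≤ dimH (range g) / c := h1.trans hdim
  rw [ENNReal.le_div_iff_mul_le (Or.inl (by exact_mod_cast hc0.ne')) (Or.inl (by simp)),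
    one_mul] at h2
  refine h2.trans (dimH_mono ?_)
  rintro _ ⟨z, rfl⟩
  exact hg z

theorem lower (S : Set ℕ) (h : ℝ)
    (hent : Tendsto
      (fun n => Real.log ((wordsOfLen (language (sGapShift S)) n).ncard) / n)
      atTop (nhds h))
    (ψ : ℕ → ℝ) (hψpos : ∀ n, 0 < ψ n) (hψanti : Antitone ψ)
    (b : ℝ≥0∞)
    (hb : atTop.liminf (fun n => ENNReal.ofReal (-Real.log (ψ n) / n)) = b) :
    ENNReal.ofReal h / (1 + b) ≤ dimH (recSet (sGapShift S) ψ) := by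
  by_cases hbt : b = ⊤
  · simp [hbt]
  lift b to ℝ≥0 using hbt
  apply ENNReal.le_of_forall_nnreal_lt
  intro c hclt
  rcases eq_or_ne c 0 with rfl | hc0
  · simp
  have hc0 : 0 < c := pos_iff_ne_zero.mpr hc0
  rw [ENNReal.lt_div_iff_mul_lt (Or.inl (by simp)) (Or.inl (by simp))] at hclt
  have hch : (c : ℝ) * (1 + b) < h := by
    have : ((c * (1 + b) : ℝ≥0) : ℝ≥0∞) < ENNReal.ofReal h := by exact_mod_cast hclt
    rw [ENNReal.lt_ofReal_iff_toReal_lt ENNReal.coe_ne_top] at this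
    rw [ENNReal.coe_toReal] at this
    exact_mod_cast this
  obtain ⟨h', hh1, hh2⟩ := exists_between hch
  have hc0' : (0 : ℝ) < c := by exact_mod_cast hc0
  have h'0 : 0 < h' := lt_of_le_of_lt (by positivity) hh1
  have hbb : (b : ℝ) < h' / c - 1 := by
    rw [lt_sub_iff_add_lt, lt_div_iff₀ hc0']; linarith
  obtain ⟨β, hβ1, hβ2⟩ := exists_between hbb
  obtain ⟨β', hβ'1, hβ'2⟩ := exists_between hβ1
  have hβ0 : 0 ≤ β := b.2.trans hβ1.le
  have hβ'0 : 0 ≤ β' := b.2.trans hβ'1.le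
  obtain ⟨N, hN, hTN⟩ := exists_block S h h' hent h'0 hh2
  have hN0 : (0 : ℝ) < N := by exact_mod_cast hN
  refine lower_core S ψ hψpos N hN h' h'0 hTN β hβ0 ?_ c hc0 ?_
  · have hfr : ∃ᶠ n : ℕ in atTop, ENNReal.ofReal (-Real.log (ψ n) / n) < ENNReal.ofReal β' := by
      refine frequently_lt_of_liminf_lt (by isBoundedDefault) ?_
      rw [hb, ENNReal.lt_ofReal_iff_toReal_lt (by simp)]
      simpa using hβ'1
    rw [frequently_atTop]
    intro m
    have hev : ∀ᶠ n : ℕ in atTop, N * m ≤ n ∧ 1 ≤ n ∧ β * N / (β - β') ≤ (n : ℝ) :=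
      (eventually_ge_atTop _).and ((eventually_ge_atTop _).and
        (tendsto_natCast_atTop_atTop.eventually_ge_atTop _))
    obtain ⟨n, hn, hnm, hn1, hn2⟩ := (hfr.and_eventually hev).exists
    have hn0 : (0 : ℝ) < n := by exact_mod_cast hn1
    have hlt : -Real.log (ψ n) / n < β' := (ENNReal.ofReal_lt_ofReal_iff'.mp hn).1
    rw [div_lt_iff₀ hn0] at hlt
    rw [div_le_iff₀ (by linarith)] at hn2
    refine ⟨n / N, ?_, ?_⟩
    · rw [Nat.le_div_iff_mul_le (by omega)]; linarith
    · have h1 : ψ n ≤ ψ (N * (n / N)) := hψanti (Nat.mul_div_le _ _)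
      have h2 := Real.log_le_log (hψpos n) h1
      have h3 : n ≤ N * (n / N) + N := by
        have := Nat.div_add_mod n N
        have := Nat.mod_lt n (show 0 < N by omega)
        omega
      have h3' : (n : ℝ) ≤ N * ((n / N : ℕ) : ℝ) + N := by exact_mod_cast h3
      have := mul_le_mul_of_nonneg_right h3' hβ0
      linarith
  · rw [lt_sub_iff_add_lt, lt_div_iff₀ hc0'] at hβ2
    linarith

end GapProof

/-- **Application to S-gap shifts.** Let `S ⊆ ℕ` be infinite and `Σ_S` the S-gap shift.
If `ψ : ℕ → (0,∞)` is nonincreasing, then `dim_H R(ψ) = h/(1+b)` with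
`h = h_top(Σ_S)` and `b = liminf (-log ψ(n))/n ∈ [0,∞]`. -/
theorem dimH_recSet_sGapShift
    (S : Set ℕ) (hS : S.Infinite)
    (h : ℝ)
    (hent : Tendsto
      (fun n => Real.log ((wordsOfLen (language (sGapShift S)) n).ncard) / n)
      atTop (nhds h))
    (ψ : ℕ → ℝ) (hψpos : ∀ n, 0 < ψ n) (hψanti : Antitone ψ)
    (b : ℝ≥0∞)
    (hb : atTop.liminf (fun n => ENNReal.ofReal (-Real.log (ψ n) / n)) = b) :
    dimH (recSet (sGapShift S) ψ) = ENNReal.ofReal h / (1 + b) := by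
  exact le_antisymm (GapProof.upper _ h hent ψ hψpos b hb)
    (GapProof.lower S h hent ψ hψpos hψanti b hb)
end
end
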